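/- Fix ε > 0. Let τ = log log D − 2 log log log D and let Ψ_D(τ) denote the proportion of fundamental discriminants d with d ≤ D for which L(1, χ_d) ≤ π²/(6 e^γ τ), where γ is the Euler–Mascheroni constant. Then for all sufficiently large D one has Ψ_D(τ) ≥ D^{−ε}. -/

import Mathlib

open Filter

/-- The Dirichlet L-function of `χ` (extended by `0` for modulus `0`). -/
noncomputable def LFun (d : ℕ) (χ : DirichletCharacter ℂ d) (s : ℂ) : ℂ :=
  if h : d ≠ 0 then
    letI : NeZero d := ⟨h⟩
    DirichletCharacter.LFunction χ s
  else 0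

/-- `𝓛_χ = Σ_p χ(p)/p` has value `L`: the partial sums over primes `p < y`
converge to `L` as `y → ∞`. -/
def HasCurlyL {d : ℕ} (χ : DirichletCharacter ℂ d) (L : ℝ) : Prop :=
  Filter.Tendsto
    (fun y : ℕ => ∑ p ∈ (Finset.range y).filter Nat.Prime, (χ p).re / (p : ℝ))
    Filter.atTop (nhds L)

/-- Number of ordered pairs `(p, q)` of primes with `p * q ≤ x` satisfying `P p q`. -/
noncomputable def pairCount (x : ℝ) (P : ℕ → ℕ → Prop) : ℕ :=
  Nat.card {pq : ℕ × ℕ // pq.1.Prime ∧ pq.2.Prime ∧ ((pq.1 * pq.2 : ℕ) : ℝ) ≤ x ∧ P pq.1 pq.2}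

/-- The race ratio `#{pq ≤ x : χ(p) = χ(q) = η} / ((1/4) #{pq ≤ x : gcd(pq, d) = 1})`,
where products of two primes are counted as ordered pairs. -/
noncomputable def raceRatio {d : ℕ} (χ : DirichletCharacter ℂ d) (η : ℂ) (x : ℝ) : ℝ :=
  (pairCount x (fun p q => χ p = η ∧ χ q = η) : ℝ) /
    ((1 / 4 : ℝ) * (pairCount x (fun p q => Nat.gcd (p * q) d = 1) : ℝ))

/-- A positive integer is a fundamental discriminant if it is `≡ 1 (mod 4)` and squarefree,
or is `4m` with `m ≡ 2, 3 (mod 4)` squarefree. -/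
def IsFundamentalDiscriminant (d : ℕ) : Prop :=
  0 < d ∧ ((d % 4 = 1 ∧ Squarefree d) ∨
    (d % 4 = 0 ∧ Squarefree (d / 4) ∧ (d / 4 % 4 = 2 ∨ d / 4 % 4 = 3)))

/-- The Generalized Riemann Hypothesis for Dirichlet L-functions: all zeros in the
critical strip lie on the critical line. -/
def GRH : Prop :=
  ∀ (d : ℕ), d ≠ 0 → ∀ (χ : DirichletCharacter ℂ d) (s : ℂ),
    LFun d χ s = 0 → 0 < s.re → s.re < 1 → s.re = 1 / 2

/-- `L(s, χ)` has no real zero `β` with `1 - c / log d ≤ β ≤ 1` (a Siegel zero). -/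
def HasNoSiegelZero (c : ℝ) (d : ℕ) (χ : DirichletCharacter ℂ d) : Prop :=
  ¬ ∃ β : ℝ, 1 - c / Real.log d ≤ β ∧ β ≤ 1 ∧ LFun d χ (β : ℂ) = 0

/-- The logarithmic integral `Li(t) = ∫_2^t du / log u`. -/
noncomputable def Li (t : ℝ) : ℝ := ∫ u in (2:ℝ)..t, 1 / Real.log u

namespace S7

open ArithmeticFunction in
lemma sum_vonMangoldt_floor (n : ℕ) :
    ∑ k ∈ Finset.Ioc 0 n, vonMangoldt k * ((n / k : ℕ) : ℝ) = Real.log (n.factorial) := by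
  have h := sum_Ioc_mul_zeta_eq_sum (R := ℝ) vonMangoldt n
  rw [← h, vonMangoldt_mul_zeta]
  clear h
  induction n with
  | zero => simp
  | succ n ih =>
    rw [Finset.sum_Ioc_succ_top (Nat.zero_le _), ih, Nat.factorial_succ]
    push_cast
    rw [Real.log_mul (by positivity) (by positivity)]
    simp [log_apply]
    ring

lemma log_factorial_lower (n : ℕ) : n * Real.log n - n ≤ Real.log (n.factorial) := by
  induction n with
  | zero => simp
  | succ n ih =>
    rw [Nat.factorial_succ]
    push_cast
    rw [Real.log_mul (by positivity) (by positivity)]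
    rcases Nat.eq_zero_or_pos n with rfl | hn
    · simp
    have hn' : (0:ℝ) < n := by exact_mod_cast hn
    have h1 : Real.log ((n+1)/n) ≤ (n+1)/n - 1 := Real.log_le_sub_one_of_pos (by positivity)
    rw [Real.log_div (by positivity) (by positivity)] at h1
    have h2 : ((n:ℝ)+1)/n - 1 = 1 / n := by field_simp; ring
    rw [h2] at h1
    have h3 : n * (Real.log (n+1) - Real.log n) ≤ 1 := by
      calc _ ≤ n * (1 / (n:ℝ)) := by gcongr
        _ = 1 := by field_simp
    nlinarith

lemma log_factorial_upper (n : ℕ) : Real.log (n.factorial) ≤ n * Real.log n := by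
  have : (n.factorial : ℝ) ≤ (n:ℝ)^n := by exact_mod_cast Nat.factorial_le_pow n
  have := Real.log_le_log (by positivity) this
  simpa using this

noncomputable def TT (n : ℕ) : ℝ := ∑ k ∈ Finset.Ioc 0 n, ArithmeticFunction.vonMangoldt k / k

lemma TT_lower {n : ℕ} (hn : 0 < n) : Real.log n - 1 ≤ TT n := by
  have hn' : (0:ℝ) < n := by exact_mod_cast hn
  have h1 : Real.log (n.factorial) ≤ n * TT n := by
    rw [← sum_vonMangoldt_floor, TT, Finset.mul_sum]
    apply Finset.sum_le_sum
    intro k hk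
    have : ((n / k : ℕ) : ℝ) ≤ n / k := Nat.cast_div_le
    calc _ ≤ ArithmeticFunction.vonMangoldt k * (n / k : ℝ) := by
          gcongr
      _ = _ := by ring
  have h2 := log_factorial_lower n
  have h3 : n * (Real.log n - 1) ≤ n * TT n := by linarith
  exact le_of_mul_le_mul_left h3 hn'

lemma TT_upper {n : ℕ} (hn : 0 < n) : TT n ≤ Real.log n + (Real.log 4 + 4) := by
  have hn' : (0:ℝ) < n := by exact_mod_cast hn
  have h1 : n * TT n ≤ Real.log (n.factorial) + Chebyshev.psi n := by
    rw [← sum_vonMangoldt_floor, TT, Finset.mul_sum, Chebyshev.psi, Nat.floor_natCast,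
      ← Finset.sum_add_distrib]
    apply Finset.sum_le_sum
    intro k hk
    have hk0 : 0 < k := (Finset.mem_Ioc.1 hk).1
    have : (n / k : ℝ) ≤ ((n / k : ℕ) : ℝ) + 1 := by
      rw [div_le_iff₀ (by exact_mod_cast hk0)]
      have := Nat.lt_div_mul_add (a := n) hk0
      have h := Nat.div_add_mod n k
      have h' := Nat.mod_lt n hk0
      have : n ≤ (n / k + 1) * k := by nlinarith
      exact_mod_cast this
    calc (n:ℝ) * (ArithmeticFunction.vonMangoldt k / k)
        = ArithmeticFunction.vonMangoldt k * (n / k : ℝ) := by ring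
      _ ≤ ArithmeticFunction.vonMangoldt k * (((n / k : ℕ) : ℝ) + 1) := by
          gcongr
      _ = _ := by ring
  have h2 := log_factorial_upper n
  have h3 := Chebyshev.psi_le_const_mul_self hn'.le
  have h3 : n * TT n ≤ n * (Real.log n + (Real.log 4 + 4)) := by linarith
  exact le_of_mul_le_mul_left h3 hn'

noncomputable def CM : ℝ := Real.log 4 + 5

lemma CM_pos : 0 < CM := by unfold CM; have := Real.log_nonneg (show (1:ℝ) ≤ 4 by norm_num); linarith

lemma window_abel {y : ℕ} (hy : 2 ≤ y) {z : ℕ} (hz : y ≤ z) :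
    ∑ k ∈ Finset.Ioc y z, ArithmeticFunction.vonMangoldt k / k / Real.log k
      - (TT z - TT y) / Real.log z ≤
    Real.log (Real.log z) - Real.log (Real.log y) + CM / Real.log y
      - (Real.log z - Real.log y + CM) / Real.log z := by
  induction z, hz using Nat.le_induction with
  | base => simp
  | succ z hz ih =>
    have hz2 : (2:ℝ) ≤ z := by exact_mod_cast hy.trans hz
    have hlz : 0 < Real.log z := Real.log_pos (by linarith)
    have hlz1 : Real.log z ≤ Real.log (z+1) := Real.log_le_log (by linarith) (by linarith)
    have hlz2 : 0 < Real.log (z+1) := by linarith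
    have hT : TT (z+1) = TT z + ArithmeticFunction.vonMangoldt (z+1) / ((z+1 : ℕ):ℝ) := by
      unfold TT; rw [Finset.sum_Ioc_succ_top (Nat.zero_le _)]
    rw [Finset.sum_Ioc_succ_top hz, hT]
    push_cast
    have hS : TT z - TT y ≤ Real.log z - Real.log y + CM := by
      have h1 := TT_upper (n := z) (by omega)
      have h2 := TT_lower (n := y) (by omega)
      unfold CM; linarith
    have hd : 0 ≤ 1 / Real.log z - 1 / Real.log (z+1) := by
      rw [sub_nonneg]; gcongr
    have hm := mul_le_mul_of_nonneg_right hS hd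
    have hl : 1 - Real.log z / Real.log (z+1) ≤ Real.log (Real.log (z+1)) - Real.log (Real.log z) := by
      have := Real.one_sub_inv_le_log_of_pos (x := Real.log (z+1) / Real.log z) (by positivity)
      rw [Real.log_div hlz2.ne' hlz.ne'] at this
      simpa using this
    have e1 : (Real.log (z+1) - Real.log y + CM) / Real.log (z+1)
      = (1 - Real.log z / Real.log (z+1)) + (Real.log z - Real.log y + CM) * (1/Real.log (z+1)) := by
      field_simp; ring
    rw [e1]
    set b := ArithmeticFunction.vonMangoldt (z+1) / ((z:ℝ)+1)
    have e2 : (TT z + b - TT y) / Real.log (z+1) = b / Real.log (z+1) + (TT z - TT y) * (1/Real.log (z+1)) := by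
      field_simp; ring
    rw [e2]
    have e3 : (TT z - TT y) / Real.log z = (TT z - TT y) * (1/Real.log z) := by ring
    have e4 : (Real.log z - Real.log y + CM) / Real.log z = (Real.log z - Real.log y + CM) * (1/Real.log z) := by ring
    rw [e3, e4] at ih
    nlinarith

lemma window_Lambda {y : ℕ} (hy : 2 ≤ y) {z : ℕ} (hz : y ≤ z) :
    ∑ k ∈ Finset.Ioc y z, ArithmeticFunction.vonMangoldt k / k / Real.log k ≤
    Real.log (Real.log z) - Real.log (Real.log y) + CM / Real.log y := by
  have h := window_abel hy hz
  have hS : TT z - TT y ≤ Real.log z - Real.log y + CM := by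
      have h1 := TT_upper (n := z) (by omega)
      have h2 := TT_lower (n := y) (by omega)
      unfold CM; linarith
  have hz2 : (2:ℝ) ≤ z := by exact_mod_cast hy.trans hz
  have hlz : 0 < Real.log z := Real.log_pos (by linarith)
  have : (TT z - TT y) / Real.log z ≤ (Real.log z - Real.log y + CM) / Real.log z := by gcongr
  linarith

/-- The Euler factor weight. -/
noncomputable def aw (p : ℕ) : ℝ := -Real.log (1 - 1 / (p:ℝ))

lemma aw_nonneg {p : ℕ} (hp : 2 ≤ p) : 0 ≤ aw p := by
  have : (2:ℝ) ≤ p := by exact_mod_cast hp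
  unfold aw
  have h : 1/(p:ℝ) ≤ 1/2 := by gcongr
  have h0 : 0 < 1/(p:ℝ) := by positivity
  have := Real.log_nonpos (x := 1 - 1/(p:ℝ)) (by linarith) (by linarith)
  linarith

lemma aw_le {p : ℕ} (hp : 2 ≤ p) : aw p ≤ 1 / p + (1/((p:ℝ)-1) - 1/p) := by
  have : (2:ℝ) ≤ p := by exact_mod_cast hp
  unfold aw
  have h : 1/(p:ℝ) ≤ 1/2 := by gcongr
  have := Real.one_sub_inv_le_log_of_pos (x := 1 - 1/(p:ℝ)) (by linarith)
  have e : (1 - 1/(p:ℝ))⁻¹ = 1 + 1/((p:ℝ)-1) := by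
    have : (p:ℝ) - 1 ≠ 0 := by linarith
    have : (p:ℝ) ≠ 0 := by linarith
    field_simp; ring
  rw [e] at this
  linarith

lemma telescope {y z : ℕ} (hz : y ≤ z) :
    ∑ k ∈ Finset.Ioc y z, (1/((k:ℝ)-1) - 1/k) = 1/(y:ℝ) - 1/z := by
  induction z, hz using Nat.le_induction with
  | base => simp
  | succ z hz ih =>
    rw [Finset.sum_Ioc_succ_top hz, ih]; push_cast; ring

noncomputable def FF (y : ℕ) : ℝ := ∑ p ∈ (Finset.Ioc 0 y).filter Nat.Prime, aw p

lemma FF_window {y z : ℕ} (hy : 2 ≤ y) (hz : y ≤ z) :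
    FF z ≤ FF y + Real.log (Real.log z) - Real.log (Real.log y) + (CM + 1) / Real.log y := by
  have h1 : FF z = FF y + ∑ p ∈ (Finset.Ioc y z).filter Nat.Prime, aw p := by
    unfold FF
    rw [← Finset.sum_union]
    · congr 1
      rw [← Finset.filter_union, Finset.Ioc_union_Ioc_eq_Ioc (Nat.zero_le _) hz]
    · apply Finset.disjoint_filter_filter
      rw [Finset.disjoint_left]; intro a; simp; omega
  have h2 : ∑ p ∈ (Finset.Ioc y z).filter Nat.Prime, aw p ≤
      ∑ k ∈ Finset.Ioc y z, (ArithmeticFunction.vonMangoldt k / k / Real.log k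
        + (1/((k:ℝ)-1) - 1/k)) := by
    rw [Finset.sum_filter]
    apply Finset.sum_le_sum
    intro k hk
    have hk2 : 2 < k := by have := (Finset.mem_Ioc.1 hk).1; omega
    have hk2' : (2:ℝ) < k := by exact_mod_cast hk2
    split_ifs with hp
    · refine (aw_le hk2.le).trans ?_
      rw [ArithmeticFunction.vonMangoldt_apply_prime hp]
      have : Real.log k ≠ 0 := (Real.log_pos (by linarith)).ne'
      have e : Real.log k / k / Real.log k = 1/(k:ℝ) := by field_simp
      rw [e]
    · have : 1/(k:ℝ) ≤ 1/((k:ℝ)-1) := by apply one_div_le_one_div_of_le <;> linarith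
      have h3 : 0 ≤ ArithmeticFunction.vonMangoldt k := ArithmeticFunction.vonMangoldt_nonneg
      have h4 : 0 ≤ Real.log k := (Real.log_pos (by linarith)).le
      have : 0 ≤ ArithmeticFunction.vonMangoldt k / k / Real.log k := by positivity
      linarith
  rw [Finset.sum_add_distrib, telescope hz] at h2
  have h3 := window_Lambda hy hz
  have hy' : (2:ℝ) ≤ y := by exact_mod_cast hy
  have hz' : (2:ℝ) ≤ z := by exact_mod_cast hy.trans hz
  have h4 : 1/(y:ℝ) ≤ 1 / Real.log y := by
    apply one_div_le_one_div_of_le (Real.log_pos (by linarith))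
    have := Real.log_le_sub_one_of_pos (x := (y:ℝ)) (by linarith)
    linarith
  have h5 : 0 < 1/(z:ℝ) := by positivity
  rw [h1, add_div]
  linarith

open MeasureTheory Set in
lemma gamma_integral :
    IntegrableOn (fun t : ℝ => Real.log t * Real.exp (-t)) (Ioi 0) ∧
    ∫ t in Ioi (0:ℝ), Real.log t * Real.exp (-t) = -Real.eulerMascheroniConstant := by
  have h2 : ∫ t in Ioi (0:ℝ), Real.log t * Real.exp (-t) = -Real.eulerMascheroniConstant := by
    have h := Complex.hasDerivAt_GammaIntegral (s := 1) (by simp)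
    have h' := Complex.hasDerivAt_Gamma_one
    have he : Complex.Gamma =ᶠ[nhds 1] Complex.GammaIntegral := by
      have : IsOpen {s : ℂ | 0 < s.re} := Complex.continuous_re.isOpen_preimage _ isOpen_Ioi
      filter_upwards [this.mem_nhds (show (1:ℂ) ∈ {s : ℂ | 0 < s.re} by simp)] with s hs
      exact Complex.Gamma_eq_integral hs
    have h3 := h.unique (h'.congr_of_eventuallyEq he.symm)
    have h4 : ((∫ t in Ioi (0:ℝ), Real.log t * Real.exp (-t) : ℝ) : ℂ) =
        ((-Real.eulerMascheroniConstant : ℝ) : ℂ) := by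
      rw [← integral_complex_ofReal]
      push_cast
      rw [← h3]
      simp
    exact_mod_cast h4
  refine ⟨?_, h2⟩
  by_contra hcon
  have := integral_undef hcon
  rw [this] at h2
  have := Real.one_half_lt_eulerMascheroniConstant
  linarith

end S7

namespace S7

open MeasureTheory Set in
lemma mertens_aux {y : ℕ} (hy : 2 ≤ y) {σ : ℝ} (hσ : 0 < σ) (n : ℕ) :
    ∑ p ∈ (Finset.Ioc 0 n).filter Nat.Prime, aw p * (p:ℝ) ^ (-σ) ≤
      FF y + (CM + 1) / Real.log y - Real.eulerMascheroniConstant - Real.log (σ * Real.log y)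
        + 2 * √(σ * Real.log y) * Real.Gamma (1/2) := by
  have hy' : (2:ℝ) ≤ y := by exact_mod_cast hy
  set L := Real.log y with hL
  have hLpos : 0 < L := Real.log_pos (by linarith)
  set η := σ * L with hη
  have hηpos : 0 < η := by positivity
  set Pn := (Finset.Ioc 0 n).filter Nat.Prime with hPn
  -- integral representation
  have hrep : ∑ p ∈ Pn, aw p * (p:ℝ) ^ (-σ) =
      ∫ v in Ioi (0:ℝ), ∑ p ∈ Pn, aw p * (Ioi (σ * Real.log p)).indicator (fun v => Real.exp (-v)) v := by
    rw [integral_finsetSum]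
    · apply Finset.sum_congr rfl
      intro p hp
      have hp1 : (1:ℝ) ≤ p := by exact_mod_cast (Finset.mem_filter.1 hp).2.one_lt.le
      rw [integral_const_mul, setIntegral_indicator measurableSet_Ioi, Ioi_inter_Ioi,
        max_eq_right (mul_nonneg hσ.le (Real.log_nonneg hp1)), integral_exp_neg_Ioi,
        Real.rpow_def_of_pos (by linarith)]
      congr 2; ring
    · intro p hp
      apply Integrable.const_mul
      apply Integrable.indicator _ measurableSet_Ioi
      exact integrableOn_exp_neg_Ioi 0
  have hΓ := Real.GammaIntegral_convergent (s := 1/2) (by norm_num)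
  have hΓ' := Real.Gamma_eq_integral (s := 1/2) (by norm_num)
  obtain ⟨hγi, hγ⟩ := gamma_integral
  set K := FF y + (CM + 1) / L - Real.log η with hK
  have hexp : IntegrableOn (fun v : ℝ => Real.exp (-v)) (Ioi 0) := integrableOn_exp_neg_Ioi 0
  have hbd : ∫ v in Ioi (0:ℝ), (K * Real.exp (-v) + Real.log v * Real.exp (-v) +
      2 * √η * (Real.exp (-v) * v ^ ((1/2:ℝ) - 1))) = K - Real.eulerMascheroniConstant
        + 2 * √η * Real.Gamma (1/2) := by
    have hA : IntegrableOn (fun v : ℝ => K * Real.exp (-v) + Real.log v * Real.exp (-v)) (Ioi 0) :=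
      (hexp.const_mul K).add hγi
    rw [integral_add hA (hΓ.const_mul _),
      integral_add (hexp.const_mul K) hγi, integral_const_mul, integral_const_mul, hγ, ← hΓ',
      integral_exp_neg_Ioi]
    simp; ring
  have hcm := CM_pos
  rw [hrep]
  calc _ ≤ ∫ v in Ioi (0:ℝ), (K * Real.exp (-v) + Real.log v * Real.exp (-v) +
      2 * √η * (Real.exp (-v) * v ^ ((1/2:ℝ) - 1))) := by
        apply setIntegral_mono_on
        · apply integrable_finsetSum
          intro p hp
          apply Integrable.const_mul
          apply Integrable.indicator _ measurableSet_Ioi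
          exact integrableOn_exp_neg_Ioi 0
        · exact ((hexp.const_mul K).add hγi).add (hΓ.const_mul _)
        · exact measurableSet_Ioi
        · intro v hv
          have hv : 0 < v := hv
          have e1 : ∑ p ∈ Pn, aw p * (Ioi (σ * Real.log p)).indicator (fun v => Real.exp (-v)) v
            ≤ FF ⌊Real.exp (v/σ)⌋₊ * Real.exp (-v) := by
            unfold FF
            rw [Finset.sum_mul]
            calc _ ≤ ∑ p ∈ Pn.filter (fun p : ℕ => σ * Real.log p < v), aw p * Real.exp (-v) := by
                  rw [Finset.sum_filter (fun p : ℕ => σ * Real.log p < v)]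
                  apply Finset.sum_le_sum
                  intro p hp
                  by_cases h : σ * Real.log p < v
                  · simp [h]
                  · simp [h]
              _ ≤ _ := by
                  apply Finset.sum_le_sum_of_subset_of_nonneg
                  · intro p hp
                    simp only [hPn, Finset.mem_filter, Finset.mem_Ioc] at hp ⊢
                    refine ⟨⟨hp.1.1.1, ?_⟩, hp.1.2⟩
                    apply Nat.le_floor
                    rw [← Real.log_le_iff_le_exp (by exact_mod_cast hp.1.1.1), le_div_iff₀ hσ]
                    linarith
                  · intro p hp _
                    have := aw_nonneg (Finset.mem_filter.1 hp).2.two_le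
                    positivity
          have e2 : FF ⌊Real.exp (v/σ)⌋₊ ≤ K + Real.log v + 2 * √η * v ^ ((1/2:ℝ) - 1) := by
            have e3 : 2 * √η * v ^ ((1/2:ℝ) - 1) = 2 * √(η / v) := by
              rw [Real.sqrt_div' _ hv.le, Real.sqrt_eq_rpow v, Real.rpow_sub hv]
              have : v ^ (1/2:ℝ) * v ^ (1/2:ℝ) = v := by
                rw [← Real.rpow_add hv]; norm_num
              have h0 : v ^ (1/2:ℝ) ≠ 0 := by positivity
              rw [Real.rpow_one]
              field_simp
              rw [pow_two, this]
            rw [e3]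
            have hCL : 0 < (CM+1)/L := by positivity
            by_cases hc : y ≤ ⌊Real.exp (v/σ)⌋₊
            · have h := FF_window hy hc
              set z := ⌊Real.exp (v/σ)⌋₊
              have hz' : (2:ℝ) ≤ z := by exact_mod_cast hy.trans hc
              have hlz : Real.log z ≤ v / σ := by
                rw [Real.log_le_iff_le_exp (by linarith)]
                exact Nat.floor_le (Real.exp_pos _).le
              have hlz0 : 0 < Real.log z := Real.log_pos (by linarith)
              have h2 : Real.log (Real.log z) ≤ Real.log (v/σ) := Real.log_le_log hlz0 hlz
              rw [Real.log_div hv.ne' hσ.ne'] at h2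
              have h3 : Real.log η = Real.log σ + Real.log L := Real.log_mul hσ.ne' hLpos.ne'
              have : 0 ≤ 2 * √(η/v) := by positivity
              rw [hK, h3]; linarith
            · push Not at hc
              have h1 : FF ⌊Real.exp (v/σ)⌋₊ ≤ FF y := by
                unfold FF
                apply Finset.sum_le_sum_of_subset_of_nonneg
                · apply Finset.filter_subset_filter
                  apply Finset.Ioc_subset_Ioc_right hc.le
                · intro p hp _
                  exact aw_nonneg (Finset.mem_filter.1 hp).2.two_le
              have h2 : Real.log (η/v) ≤ 2 * √(η/v) := by
                have h : 0 < √(η/v) := by positivity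
                have := Real.log_le_sub_one_of_pos h
                rw [Real.log_sqrt (by positivity)] at this
                linarith
              rw [Real.log_div hηpos.ne' hv.ne'] at h2
              rw [hK]; linarith
          calc _ ≤ FF ⌊Real.exp (v/σ)⌋₊ * Real.exp (-v) := e1
            _ ≤ (K + Real.log v + 2 * √η * v ^ ((1/2:ℝ) - 1)) * Real.exp (-v) := by gcongr
            _ = _ := by ring
    _ = K - Real.eulerMascheroniConstant + 2 * √η * Real.Gamma (1/2) := hbd
    _ = _ := by rw [hK]; ring

lemma euler_factor_le {p : ℕ} (hp : 2 ≤ p) {σ : ℝ} (hσ : 0 < σ) :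
    (1 - (p:ℝ) ^ (-(1+σ)))⁻¹ ≤ Real.exp (aw p * (p:ℝ) ^ (-σ)) := by
  have hp' : (2:ℝ) ≤ p := by exact_mod_cast hp
  have hp0 : (0:ℝ) < p := by linarith
  set t := (p:ℝ) ^ (-σ) with ht
  have ht0 : 0 < t := by positivity
  have ht1 : t ≤ 1 := Real.rpow_le_one_of_one_le_of_nonpos (by linarith) (by linarith)
  have e : (p:ℝ) ^ (-(1+σ)) = 1/p * t := by
    rw [neg_add, Real.rpow_add hp0, Real.rpow_neg_one]; simp [ht]
  rw [e]
  have hu : 1/(p:ℝ) ≤ 1/2 := by gcongr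
  have hu0 : 0 < 1/(p:ℝ) := by positivity
  have hpos : 0 < 1 - 1/(p:ℝ) := by linarith
  -- Bernoulli: (1-u)^t ≤ 1 - u t
  have hb : (1 - 1/(p:ℝ)) ^ t ≤ 1 - 1/p * t := by
    have := rpow_one_add_le_one_add_mul_self (s := -(1/(p:ℝ))) (by linarith) ht0.le ht1
    have e1 : (1 + -(1/(p:ℝ))) = 1 - 1/p := by ring
    rw [e1] at this
    linarith
  have he : Real.exp (aw p * t) = ((1 - 1/(p:ℝ)) ^ t)⁻¹ := by
    rw [Real.rpow_def_of_pos hpos, ← Real.exp_neg]; unfold aw; congr 1; ring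
  rw [he]
  have : 0 < (1 - 1/(p:ℝ)) ^ t := by positivity
  gcongr

lemma zeta_le {y : ℕ} (hy : 2 ≤ y) {σ : ℝ} (hσ : 0 < σ) :
    (riemannZeta ((1 + σ : ℝ) : ℂ)).re ≤ Real.exp
      (FF y + (CM + 1) / Real.log y - Real.eulerMascheroniConstant - Real.log (σ * Real.log y)
        + 2 * √(σ * Real.log y) * Real.Gamma (1/2)) := by
  have h := riemannZeta_eulerProduct (s := ((1+σ : ℝ) : ℂ)) (by simpa using hσ)
  have h' := (Complex.continuous_re.tendsto _).comp h
  refine le_of_tendsto h' (Eventually.of_forall fun n => ?_)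
  have e : (∏ p ∈ Nat.primesBelow n, (1 - (p : ℂ) ^ (-((1+σ : ℝ) : ℂ)))⁻¹) =
      ((∏ p ∈ Nat.primesBelow n, (1 - (p : ℝ) ^ (-(1+σ : ℝ)))⁻¹ : ℝ) : ℂ) := by
    push_cast
    apply Finset.prod_congr rfl
    intro p hp
    rw [Complex.ofReal_cpow (by positivity)]
    push_cast; rfl
  simp only [Function.comp]
  rw [e, Complex.ofReal_re]
  calc _ ≤ ∏ p ∈ Nat.primesBelow n, Real.exp (aw p * (p:ℝ) ^ (-σ)) := by
        apply Finset.prod_le_prod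
        · intro p hp
          have hp2 := (Nat.prime_of_mem_primesBelow hp).two_le
          rw [inv_nonneg, sub_nonneg]
          apply Real.rpow_le_one_of_one_le_of_nonpos
          · exact_mod_cast (by omega : 1 ≤ p)
          · linarith
        · intro p hp
          exact euler_factor_le (Nat.prime_of_mem_primesBelow hp).two_le hσ
    _ = Real.exp (∑ p ∈ Nat.primesBelow n, aw p * (p:ℝ) ^ (-σ)) := (Real.exp_sum _ _).symm
    _ ≤ _ := by
      apply Real.exp_le_exp.2
      refine le_trans ?_ (mertens_aux hy hσ n)
      apply Finset.sum_le_sum_of_subset_of_nonneg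
      · intro p hp
        have := Nat.prime_of_mem_primesBelow hp
        have h2 := Nat.lt_of_mem_primesBelow hp
        simp [this, this.pos, h2.le]
      · intro p hp _
        have := aw_nonneg (Finset.mem_filter.1 hp).2.two_le
        positivity

theorem mertens_lower {y : ℕ} (hy : 2 ≤ y) :
    Real.log (Real.log y) + Real.eulerMascheroniConstant - (CM + 1) / Real.log y ≤ FF y := by
  have hy' : (2:ℝ) ≤ y := by exact_mod_cast hy
  have hLpos : 0 < Real.log y := Real.log_pos (by linarith)
  set L := Real.log y
  -- zeta (1+σ) ≥ 1/σ eventually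
  have hz : ∀ᶠ σ : ℝ in nhdsWithin 0 (Set.Ioi 0), 1/σ ≤ (riemannZeta ((1 + σ : ℝ) : ℂ)).re := by
    have h := ZetaAsymptotics.tendsto_riemannZeta_sub_one_div_nhds_right
    have h' := (Complex.continuous_re.tendsto _).comp h
    have hm : Tendsto (fun σ : ℝ => 1 + σ) (nhdsWithin 0 (Set.Ioi 0)) (nhdsWithin 1 (Set.Ioi 1)) := by
      apply tendsto_nhdsWithin_of_tendsto_nhds_of_eventually_within
      · have : Tendsto (fun σ : ℝ => 1 + σ) (nhds 0) (nhds (1+0)) := by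
          apply Continuous.tendsto; fun_prop
        rw [add_zero] at this
        exact this.mono_left nhdsWithin_le_nhds
      · filter_upwards [self_mem_nhdsWithin] with σ hσ
        simpa using hσ
    have h2 := h'.comp hm
    have hpos : (0:ℝ) < (Real.eulerMascheroniConstant : ℂ).re := by
      have := Real.one_half_lt_eulerMascheroniConstant
      simp; linarith
    filter_upwards [h2.eventually (lt_mem_nhds hpos)] with σ hσ
    simp only [Function.comp, Complex.sub_re] at hσ
    have e : (1 / (((1+σ : ℝ) : ℂ) - 1)).re = 1/σ := by
      have : (1 / (((1+σ : ℝ) : ℂ) - 1)) = ((1/σ : ℝ) : ℂ) := by push_cast; ring_nf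
      rw [this, Complex.ofReal_re]
    rw [e] at hσ
    linarith
  have hineq : ∀ᶠ σ : ℝ in nhdsWithin 0 (Set.Ioi 0),
      Real.log L + Real.eulerMascheroniConstant - (CM + 1) / L
        - 2 * √(σ * L) * Real.Gamma (1/2) ≤ FF y := by
    filter_upwards [hz, self_mem_nhdsWithin] with σ hσ hpos
    have hpos : 0 < σ := hpos
    have h1 := hσ.trans (zeta_le hy hpos)
    have h2 := Real.log_le_log (by positivity) h1
    rw [Real.log_exp, Real.log_mul hpos.ne' hLpos.ne', one_div, Real.log_inv] at h2
    linarith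
  have hlim : Tendsto (fun σ : ℝ => Real.log L + Real.eulerMascheroniConstant - (CM + 1) / L
        - 2 * √(σ * L) * Real.Gamma (1/2)) (nhdsWithin 0 (Set.Ioi 0))
        (nhds (Real.log L + Real.eulerMascheroniConstant - (CM + 1) / L)) := by
    have : Continuous (fun σ : ℝ => Real.log L + Real.eulerMascheroniConstant - (CM + 1) / L
        - 2 * √(σ * L) * Real.Gamma (1/2)) := by fun_prop
    have := this.tendsto 0
    simp only [zero_mul, Real.sqrt_zero, mul_zero, sub_zero] at this
    exact this.mono_left nhdsWithin_le_nhds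
  exact le_of_tendsto hlim hineq

end S7

namespace S7

open ZMod in
lemma geom_bound {q : ℕ} [NeZero q] {b : ℕ} (hb : 0 < b) (hbq : b < q) (t : ℕ) :
    ‖∑ n ∈ Finset.range t, (stdAddChar (b : ZMod q) : ℂ) ^ n‖ ≤
      (q:ℝ) / 2 * ((b:ℝ)⁻¹ + ((q:ℝ) - b)⁻¹) := by
  have hq : (0:ℝ) < q := by exact_mod_cast (hb.trans hbq)
  have hb' : (0:ℝ) < b := by exact_mod_cast hb
  have hbq' : (0:ℝ) < (q:ℝ) - b := by
    have : (b:ℝ) < q := by exact_mod_cast hbq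
    linarith
  set z : ℂ := stdAddChar (b : ZMod q) with hz
  have hz1 : ‖z‖ = 1 := by
    rw [hz, stdAddChar_apply]; exact Circle.norm_coe _
  set x : ℝ := Real.pi * b / q with hx
  have hze : z = Complex.exp (Complex.I * ((2 * x : ℝ) : ℂ)) := by
    have := stdAddChar_coe (N := q) (b : ℤ)
    rw [hz]
    push_cast at this ⊢
    rw [this, hx]
    push_cast
    congr 1; field_simp
  have hnorm : ‖z - 1‖ = 2 * |Real.sin x| := by
    rw [hze, Complex.norm_exp_I_mul_ofReal_sub_one]
    rw [mul_div_cancel_left₀ _ (two_ne_zero)]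
    simp
  have hpi := Real.pi_pos
  have hx0 : 0 ≤ x := by positivity
  have hlow : 2 * min (b:ℝ) (q - b) / q ≤ |Real.sin x| := by
    refine le_trans ?_ (le_abs_self _)
    by_cases hc : x ≤ Real.pi / 2
    · refine le_trans ?_ (Real.mul_le_sin hx0 hc)
      calc 2 * min (b:ℝ) (q - b) / q ≤ 2 * b / q := by gcongr; exact min_le_left _ _
        _ = 2 / Real.pi * x := by rw [hx]; field_simp
    · push Not at hc
      have e : Real.pi - x = Real.pi * (q - b) / q := by rw [hx]; field_simp
      have h0 : 0 ≤ Real.pi - x := by rw [e]; positivity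
      rw [← Real.sin_pi_sub]
      refine le_trans ?_ (Real.mul_le_sin h0 (by linarith))
      calc 2 * min (b:ℝ) (q - b) / q ≤ 2 * (q - b) / q := by gcongr; exact min_le_right _ _
        _ = 2 / Real.pi * (Real.pi - x) := by rw [e]; field_simp
  have hm : 0 < min (b:ℝ) (q - b) := lt_min hb' hbq'
  have hpos : 0 < ‖z - 1‖ := by
    rw [hnorm]
    have : 0 < 2 * min (b:ℝ) (q - b) / q := by positivity
    linarith
  have hz1' : z ≠ 1 := by
    intro h; rw [h] at hpos; simp at hpos
  rw [geom_sum_eq hz1', norm_div, div_le_iff₀ hpos]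
  have h1 : ‖z ^ t - 1‖ ≤ 2 := by
    refine (norm_sub_le _ _).trans ?_
    simp [hz1]; norm_num
  refine h1.trans ?_
  rw [hnorm]
  have h2 : (min (b:ℝ) (q - b))⁻¹ ≤ (b:ℝ)⁻¹ + ((q:ℝ) - b)⁻¹ := by
    have : 0 < (b:ℝ)⁻¹ := by positivity
    have : 0 < ((q:ℝ)-b)⁻¹ := by positivity
    rcases min_choice (b:ℝ) (q - b) with h | h <;> rw [h] <;> linarith
  calc (2:ℝ) = q / 2 * (min (b:ℝ) (q - b))⁻¹ * (2 * (2 * min (b:ℝ) (q - b) / q)) := by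
        field_simp
    _ ≤ _ := by gcongr

open ZMod in
theorem polya {q : ℕ} [NeZero q] (hq1 : 1 < q) {χ : DirichletCharacter ℂ q}
    (hχ : χ.IsPrimitive) (hquad : MulChar.IsQuadratic χ) (t : ℕ) :
    ‖∑ n ∈ Finset.range t, χ n‖ ≤ √q * (1 + Real.log q) := by
  have hq : (0:ℝ) < q := by exact_mod_cast (by omega)
  set τ := gaussSum χ (stdAddChar (N := q)) with hτ
  have hinv : χ⁻¹ = χ := hquad.inv
  have hF : ∀ k, ZMod.dft (χ : ZMod q → ℂ) k = χ (-k) * τ := by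
    intro k
    have := hχ.fourierTransform_eq_inv_mul_gaussSum k
    rw [hinv] at this
    exact this
  have hτ2 : ‖τ‖ ^ 2 = q := by
    have h1 := congrFun (ZMod.dft_dft (χ : ZMod q → ℂ)) (-1)
    have h2 : ZMod.dft (χ : ZMod q → ℂ) = fun k => τ * χ (-1) * χ k := by
      funext k; rw [hF, ← neg_one_mul k, map_mul]; ring
    rw [h2] at h1
    have h3 : (fun k => τ * χ (-1) * χ k) = (τ * χ (-1)) • (χ : ZMod q → ℂ) := by
      funext k; simp
    rw [h3, _root_.map_smul] at h1
    simp only [Pi.smul_apply, smul_eq_mul, hF, neg_neg, map_one, mul_one, one_mul] at h1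
    have h4 : ‖χ (-1)‖ = 1 := by
      have : IsUnit (-1 : ZMod q) := isUnit_one.neg
      obtain ⟨u, hu⟩ := this
      rw [← hu]; exact χ.unit_norm_eq_one u
    have h5 := congrArg norm h1
    rw [norm_mul, norm_mul, h4] at h5
    simpa [pow_two] using h5
  have hτn : ‖τ‖ = √q := by
    rw [← hτ2, Real.sqrt_sq (norm_nonneg _)]
  -- key identity
  have key : τ * ∑ n ∈ Finset.range t, χ n =
      ∑ b ∈ Finset.range q, χ (b : ZMod q) * ∑ n ∈ Finset.range t, (stdAddChar (b : ZMod q) : ℂ) ^ n := by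
    have h1 : ∀ n : ℕ, τ * χ n = ∑ b : ZMod q, χ b * stdAddChar b ^ n := by
      intro n
      have := gaussSum_mulShift_of_isPrimitive (stdAddChar (N := q)) hχ (n : ZMod q)
      rw [hinv] at this
      rw [mul_comm, ← this, gaussSum]
      apply Finset.sum_congr rfl
      intro b _
      rw [AddChar.mulShift_apply, ← nsmul_eq_mul, AddChar.map_nsmul_eq_pow]
    have h2 : ∀ f : ZMod q → ℂ, ∑ b : ZMod q, f b = ∑ b ∈ Finset.range q, f (b : ZMod q) := by
      intro f
      symm
      apply Finset.sum_bij' (fun (b : ℕ) _ => (b : ZMod q)) (fun b _ => b.val)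
      · simp
      · intro b _; exact Finset.mem_range.2 (ZMod.val_lt b)
      · intro b hb; exact ZMod.val_cast_of_lt (Finset.mem_range.1 hb)
      · intro b _; simp
      · intro b _; rfl
    rw [Finset.mul_sum]
    simp_rw [h1, h2]
    rw [Finset.sum_comm]
    simp_rw [Finset.mul_sum]
  have hb : ‖τ * ∑ n ∈ Finset.range t, χ n‖ ≤ q * (1 + Real.log q) := by
    rw [key, Finset.range_eq_Ico, Finset.sum_eq_sum_Ico_succ_bot (by omega)]
    have h0 : χ ((0:ℕ) : ZMod q) = 0 := by
      have : Nontrivial (ZMod q) := by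
        have : Fact (1 < q) := ⟨hq1⟩
        infer_instance
      simpa using MulChar.map_zero χ
    rw [h0, zero_mul, zero_add]
    have hH : ∑ b ∈ Finset.Ico 1 q, (b:ℝ)⁻¹ ≤ 1 + Real.log q := by
      have h := harmonic_le_one_add_log (q - 1)
      have e : ((harmonic (q-1) : ℚ) : ℝ) = ∑ b ∈ Finset.Ico 1 q, (b:ℝ)⁻¹ := by
        rw [harmonic, Finset.sum_Ico_eq_sum_range]
        push_cast
        apply Finset.sum_congr rfl
        intro i _; rw [add_comm]
      rw [← e]
      refine h.trans ?_
      have : Real.log ((q-1:ℕ):ℝ) ≤ Real.log q := by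
        apply Real.log_le_log
        · exact_mod_cast (by omega : 0 < q - 1)
        · exact_mod_cast (by omega)
      linarith
    have hH2 : ∑ b ∈ Finset.Ico 1 q, ((q:ℝ) - b)⁻¹ = ∑ b ∈ Finset.Ico 1 q, (b:ℝ)⁻¹ := by
      apply Finset.sum_bij' (fun (b : ℕ) _ => q - b) (fun b _ => q - b)
      · intro b hb; simp at hb ⊢; omega
      · intro b hb; simp at hb ⊢; omega
      · intro b hb; simp at hb ⊢; omega
      · intro b hb; simp at hb ⊢; omega
      · intro b hb; simp at hb ⊢
        rw [Nat.cast_sub (by omega)]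
    calc _ ≤ ∑ b ∈ Finset.Ico 1 q, (q:ℝ) / 2 * ((b:ℝ)⁻¹ + ((q:ℝ) - b)⁻¹) := by
          apply norm_sum_le_of_le
          intro b hb
          rw [Finset.mem_Ico] at hb
          rw [norm_mul]
          have := geom_bound (q := q) (b := b) (by omega) hb.2 t
          exact (mul_le_of_le_one_left (norm_nonneg _) (χ.norm_le_one _)).trans this
      _ = q * ∑ b ∈ Finset.Ico 1 q, (b:ℝ)⁻¹ := by
          rw [← Finset.mul_sum, Finset.sum_add_distrib, hH2]; ring
      _ ≤ _ := by gcongr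
  rw [norm_mul, hτn] at hb
  have hs : 0 < √(q:ℝ) := Real.sqrt_pos.2 hq
  have : √(q:ℝ) * ‖∑ n ∈ Finset.range t, χ n‖ ≤ √q * (√q * (1 + Real.log q)) := by
    rw [← mul_assoc, Real.mul_self_sqrt hq.le]; exact hb
  exact le_of_mul_le_mul_left this hs

end S7

namespace S7

/-- existence of a non-residue modulo an odd prime -/
lemma exists_nonres {p : ℕ} (hp : p.Prime) (h2 : p ≠ 2) : ∃ x : ℕ, jacobiSym x p = -1 := by
  have : Fact p.Prime := ⟨hp⟩
  obtain ⟨a, ha⟩ := FiniteField.exists_nonsquare (F := ZMod p) (by rw [ZMod.ringChar_zmod_n]; exact h2)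
  refine ⟨a.val, ?_⟩
  rw [← jacobiSym.legendreSym.to_jacobiSym, legendreSym.eq_neg_one_iff]
  simpa using ha

lemma jacobi_congr {a b m : ℕ} (h : a ≡ b [MOD m]) : jacobiSym a m = jacobiSym b m := by
  apply jacobiSym.mod_left'
  exact_mod_cast h

/-- the key construction -/
lemma exists_flip {p v m' : ℕ} (hp : p.Prime) (h2 : p ≠ 2) (hv : Odd v) (hm : m' ≠ 0)
    (hc : ¬ p ∣ m') : ∃ x : ℕ, x ≡ 1 [MOD m'] ∧ jacobiSym x (p ^ v * m') = -1 := by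
  obtain ⟨r, hr⟩ := exists_nonres hp h2
  have hcop : Nat.Coprime p m' := (Nat.Prime.coprime_iff_not_dvd hp).2 hc
  obtain ⟨x, hx1, hx2⟩ := Nat.chineseRemainder hcop r 1
  refine ⟨x, hx2, ?_⟩
  rw [jacobiSym.mul_right' _ (pow_ne_zero _ hp.ne_zero) hm, jacobiSym.pow_right,
    jacobi_congr hx1, jacobi_congr hx2, hr]
  simp [hv.neg_one_pow]

lemma coprime_of_jacobi {x m : ℕ} (hm : m ≠ 0) : jacobiSym x m ≠ 0 ↔ Nat.Coprime x m := by
  have : NeZero m := ⟨hm⟩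
  rw [Ne, jacobiSym.eq_zero_iff_not_coprime, not_not]
  rfl

/-- The Jacobi character modulo `d`. -/
noncomputable def jc (d : ℕ) [NeZero d] : DirichletCharacter ℂ d where
  toFun x := ((jacobiSym x.val d : ℤ) : ℂ)
  map_one' := by
    rw [ZMod.val_one_eq_one_mod]
    have : jacobiSym ((1 % d : ℕ) : ℤ) d = jacobiSym ((1:ℕ):ℤ) d := jacobi_congr (Nat.mod_modEq _ _)
    rw [this]; simp
  map_mul' a b := by
    rw [ZMod.val_mul, jacobi_congr (Nat.mod_modEq _ _)]
    push_cast
    rw [jacobiSym.mul_left]; push_cast; rfl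
  map_nonunit' a ha := by
    have : jacobiSym (a.val : ℤ) d = 0 := by
      by_contra h
      rw [← Ne, coprime_of_jacobi (NeZero.ne d)] at h
      apply ha
      have := (ZMod.isUnit_iff_coprime a.val d).2 h
      simpa using this
    show ((jacobiSym (a.val : ℤ) d : ℤ) : ℂ) = 0
    rw [this, Int.cast_zero]

lemma jc_apply (d : ℕ) [NeZero d] (n : ℕ) : jc d (n : ZMod d) = ((jacobiSym n d : ℤ) : ℂ) := by
  show ((jacobiSym ((n : ZMod d).val) d : ℤ) : ℂ) = _
  rw [ZMod.val_natCast, jacobi_congr (Nat.mod_modEq _ _)]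

lemma jc_quadratic (d : ℕ) [NeZero d] : MulChar.IsQuadratic (jc d) := by
  intro a
  rw [← ZMod.natCast_zmod_val a, jc_apply]
  rcases jacobiSym.trichotomy (a.val) d with h | h | h <;> rw [h]
  · left; simp
  · right; left; simp
  · right; right; simp

lemma jc_primitive {d : ℕ} [NeZero d] (hodd : Odd d) (hsq : Squarefree d) :
    (jc d).IsPrimitive := by
  have hd0 : d ≠ 0 := NeZero.ne d
  by_contra hne
  have hdvd := DirichletCharacter.conductor_dvd_level (jc d)
  have hfac := DirichletCharacter.factorsThrough_conductor (jc d)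
  set c := (jc d).conductor with hc
  obtain ⟨e, he⟩ := hdvd
  have he1 : e ≠ 1 := by
    rintro rfl
    apply hne
    rw [DirichletCharacter.isPrimitive_def]; omega
  obtain ⟨p, hp, e', rfl⟩ := Nat.exists_prime_and_dvd he1
  have hd : d = p ^ 1 * (c * e') := by rw [he]; ring
  have hm0 : c * e' ≠ 0 := by intro h; rw [h] at hd; simp at hd; exact hd0 hd
  have hp2 : p ≠ 2 := by
    rintro rfl
    rw [hd] at hodd
    rw [pow_one] at hodd
    exact (Nat.not_odd_iff_even.2 (even_two_mul _)) hodd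
  have hpm : ¬ p ∣ c * e' := by
    rintro ⟨g, hg⟩
    have : p * p ∣ d := ⟨g, by rw [hd, hg]; ring⟩
    have := hsq p this
    exact hp.one_lt.ne' (Nat.isUnit_iff.1 this)
  obtain ⟨x, hx1, hx2⟩ := exists_flip hp hp2 odd_one hm0 hpm
  rw [← hd] at hx2
  have hxc : Nat.Coprime x d := (coprime_of_jacobi hd0).1 (by rw [hx2]; norm_num)
  have hdvd : c ∣ d := ⟨_, he⟩
  rw [DirichletCharacter.factorsThrough_iff_ker_unitsMap hdvd] at hfac
  have hker : ZMod.unitOfCoprime x hxc ∈ (ZMod.unitsMap hdvd).ker := by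
    rw [MonoidHom.mem_ker]
    ext
    rw [ZMod.unitsMap_def, Units.coe_map]
    simp only [ZMod.coe_unitOfCoprime, Units.val_one]
    have : ((x : ℕ) : ZMod c) = ((1 : ℕ) : ZMod c) :=
      (ZMod.natCast_eq_natCast_iff _ _ _).2 (hx1.of_dvd ⟨e', rfl⟩)
    simpa using this
  have h1 := hfac hker
  rw [MonoidHom.mem_ker] at h1
  have h2 := congrArg (fun u : ℂˣ => (u : ℂ)) h1
  simp only [MulChar.coe_toUnitHom, ZMod.coe_unitOfCoprime, Units.val_one] at h2
  rw [jc_apply, hx2] at h2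
  norm_num at h2

lemma exists_neg_of_nonsquare {m : ℕ} (hodd : Odd m) (hns : ¬ IsSquare m) :
    ∃ x : ℕ, jacobiSym x m = -1 := by
  have hm0 : m ≠ 0 := by rintro rfl; simp at hodd
  obtain ⟨f, b, hbf, hf⟩ := Nat.sq_mul_squarefree m
  have hf1 : f ≠ 1 := by
    rintro rfl
    exact hns ⟨b, by rw [← hbf]; ring⟩
  obtain ⟨p, hp, hpf⟩ := Nat.exists_prime_and_dvd hf1
  obtain ⟨v, m', hpm, hm⟩ := Nat.exists_eq_pow_mul_and_not_dvd hm0 p hp.ne_one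
  have hm'0 : m' ≠ 0 := by rintro rfl; simp at hpm
  have hb0 : b ≠ 0 := by rintro rfl; simp at hbf; exact hm0 hbf.symm
  have hf0 : f ≠ 0 := hf.ne_zero
  have hp2 : p ≠ 2 := by
    rintro rfl
    exact (Nat.not_odd_iff_even.2 (even_iff_two_dvd.2 (hpf.trans ⟨b^2, by rw [← hbf]; ring⟩))) hodd
  have hv : v = m.factorization p := by
    rw [hm, Nat.factorization_mul (pow_ne_zero _ hp.ne_zero) hm'0, hp.factorization_pow]
    simp [Nat.factorization_eq_zero_of_not_dvd hpm]
  have hfp : f.factorization p = 1 := by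
    have h1 := hf.natFactorization_le_one p
    have h2 := hp.factorization_pos_of_dvd hf0 hpf
    omega
  have hvo : Odd v := by
    rw [hv, ← hbf, Nat.factorization_mul (pow_ne_zero _ hb0) hf0, Nat.factorization_pow]
    simp [hfp]
  obtain ⟨x, _, hx⟩ := exists_flip hp hp2 hvo hm'0 hpm
  exact ⟨x, by rw [hm]; exact hx⟩

lemma sum_periodic_le {m : ℕ} (f : ℕ → ℝ) (hper : ∀ j, f (m + j) = f j)
    (h0 : ∑ j ∈ Finset.range m, f j = 0) (h1 : ∀ j, |f j| ≤ 1) (J : ℕ) (hm : 0 < m) :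
    |∑ j ∈ Finset.range J, f j| ≤ m := by
  induction J using Nat.strong_induction_on with
  | _ J ih =>
    by_cases hJ : J < m
    · calc _ ≤ ∑ j ∈ Finset.range J, |f j| := Finset.abs_sum_le_sum_abs _ _
        _ ≤ ∑ j ∈ Finset.range J, (1:ℝ) := Finset.sum_le_sum (fun j _ => h1 j)
        _ = J := by simp
        _ ≤ m := by exact_mod_cast hJ.le
    · push Not at hJ
      obtain ⟨k, rfl⟩ := Nat.exists_eq_add_of_le hJ
      rw [Finset.sum_range_add, h0, zero_add]
      simp_rw [hper]
      exact ih k (by omega)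

lemma jacobi_abs_le (a : ℤ) (m : ℕ) : |(jacobiSym a m : ℝ)| ≤ 1 := by
  rcases jacobiSym.trichotomy a m with h | h | h <;> simp [h]

lemma jacobi_ap_sum {m a Q : ℕ} (hodd : Odd m) (hns : ¬ IsSquare m) (hc : Nat.Coprime Q m) (J : ℕ) :
    |∑ j ∈ Finset.range J, ((jacobiSym ((a + Q * j : ℕ) : ℤ) m : ℤ) : ℝ)| ≤ m := by
  have hm0 : m ≠ 0 := by rintro rfl; simp at hodd
  have : NeZero m := ⟨hm0⟩
  apply sum_periodic_le (fun j => ((jacobiSym ((a + Q * j : ℕ) : ℤ) m : ℤ) : ℝ))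
  · intro j
    show ((jacobiSym ((a + Q * (m + j) : ℕ) : ℤ) m : ℤ) : ℝ) = _
    congr 1
    apply jacobi_congr
    rw [show a + Q * (m + j) = a + Q * j + m * Q by ring]
    simp [Nat.ModEq]
  · have hne : jc m ≠ 1 := by
      intro h
      obtain ⟨x, hx⟩ := exists_neg_of_nonsquare hodd hns
      have h1 := jc_apply m x
      have hxc : Nat.Coprime x m := (coprime_of_jacobi hm0).1 (by rw [hx]; norm_num)
      rw [h, hx, MulChar.one_apply ((ZMod.isUnit_iff_coprime x m).2 hxc)] at h1
      norm_num at h1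
    have hs := MulChar.sum_eq_zero_of_ne_one hne
    have hu := ZMod.unitOfCoprime Q hc
    have h2 : ∑ j ∈ Finset.range m, jc m ((a + Q * j : ℕ) : ZMod m) = ∑ x : ZMod m, jc m x := by
      let u := ZMod.unitOfCoprime Q hc
      apply Finset.sum_bij' (fun (j : ℕ) _ => ((a + Q * j : ℕ) : ZMod m))
        (fun x _ => ((u⁻¹ : (ZMod m)ˣ) * (x - a) : ZMod m).val)
      · simp
      · intro x _; exact Finset.mem_range.2 (ZMod.val_lt _)
      · intro j hj
        have : ((u⁻¹ : (ZMod m)ˣ) : ZMod m) * (((a + Q * j : ℕ) : ZMod m) - a) = (j : ZMod m) := by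
          push_cast
          rw [add_sub_cancel_left, ← ZMod.coe_unitOfCoprime Q hc, ← mul_assoc, Units.inv_mul, one_mul]
        rw [this]
        exact ZMod.val_cast_of_lt (Finset.mem_range.1 hj)
      · intro x _
        push_cast
        rw [ZMod.natCast_zmod_val, ← ZMod.coe_unitOfCoprime Q hc, ← mul_assoc, Units.mul_inv, one_mul]
        ring
      · intro j _; rfl
    rw [hs] at h2
    simp_rw [jc_apply] at h2
    have h3 : ((∑ j ∈ Finset.range m, ((jacobiSym ((a + Q * j : ℕ) : ℤ) m : ℤ) : ℝ) : ℝ) : ℂ) = 0 := by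
      push_cast at h2 ⊢
      exact h2
    exact_mod_cast h3
  · intro j; exact jacobi_abs_le _ _
  · omega

end S7

namespace S7

lemma abel_identity (a b : ℕ → ℂ) (N K : ℕ) (h : N ≤ K) :
    ∑ n ∈ Finset.Ico N K, a n * b n =
      a K * ∑ i ∈ Finset.range K, b i - a N * ∑ i ∈ Finset.range N, b i +
      ∑ n ∈ Finset.Ico N K, (a n - a (n+1)) * ∑ i ∈ Finset.range (n+1), b i := by
  induction K, h using Nat.le_induction with
  | base => simp
  | succ K hK ih =>
    rw [Finset.sum_Ico_succ_top hK, ih, Finset.sum_Ico_succ_top hK, Finset.sum_range_succ]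
    ring

lemma abel_bound (a : ℕ → ℝ) (b : ℕ → ℂ) {N : ℕ} {B : ℝ} (K : ℕ) (hK : N ≤ K)
    (ha : ∀ n, N ≤ n → a (n+1) ≤ a n) (ha0 : ∀ n, N ≤ n → 0 ≤ a n)
    (hB : ∀ t, ‖∑ i ∈ Finset.range t, b i‖ ≤ B) :
    ‖∑ n ∈ Finset.Ico N K, (a n : ℂ) * b n‖ ≤ 2 * B * a N := by
  rw [abel_identity (fun n => (a n : ℂ)) b N K hK]
  have hB0 : 0 ≤ B := (norm_nonneg _).trans (hB 0)
  have h1 : ‖(a K : ℂ) * ∑ i ∈ Finset.range K, b i‖ ≤ a K * B := by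
    rw [norm_mul, Complex.norm_real, Real.norm_of_nonneg (ha0 K hK)]
    exact mul_le_mul_of_nonneg_left (hB K) (ha0 K hK)
  have h2 : ‖(a N : ℂ) * ∑ i ∈ Finset.range N, b i‖ ≤ a N * B := by
    rw [norm_mul, Complex.norm_real, Real.norm_of_nonneg (ha0 N le_rfl)]
    exact mul_le_mul_of_nonneg_left (hB N) (ha0 N le_rfl)
  have h3 : ‖∑ n ∈ Finset.Ico N K, ((a n : ℂ) - (a (n+1) : ℂ)) * ∑ i ∈ Finset.range (n+1), b i‖
      ≤ (a N - a K) * B := by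
    calc _ ≤ ∑ n ∈ Finset.Ico N K, (a n - a (n+1)) * B := by
          apply norm_sum_le_of_le
          intro n hn
          have hn := (Finset.mem_Ico.1 hn).1
          have h0 : 0 ≤ a n - a (n+1) := by linarith [ha n hn]
          rw [norm_mul, ← Complex.ofReal_sub, Complex.norm_real, Real.norm_of_nonneg h0]
          exact mul_le_mul_of_nonneg_left (hB _) h0
      _ = (a N - a K) * B := by
          rw [← Finset.sum_mul]
          congr 1
          have := Finset.sum_Ico_sub a hK
          have h4 : ∑ n ∈ Finset.Ico N K, (a n - a (n+1)) = - ∑ n ∈ Finset.Ico N K, (a (n+1) - a n) := by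
            rw [← Finset.sum_neg_distrib]; apply Finset.sum_congr rfl; intros; ring
          rw [h4, this]; ring
  calc _ ≤ a K * B + a N * B + (a N - a K) * B :=
        (norm_add_le _ _).trans (add_le_add ((norm_sub_le _ _).trans (add_le_add h1 h2)) h3)
    _ = _ := by ring

lemma trunc_s {M : ℕ} [NeZero M] (ψ : DirichletCharacter ℂ M) {B : ℝ}
    (hB : ∀ t, ‖∑ i ∈ Finset.range t, ψ i‖ ≤ B) {N : ℕ} (hN : 1 ≤ N) {s : ℝ} (hs : 1 < s) :
    ‖ψ.LFunction s - ∑ n ∈ Finset.range N, LSeries.term (fun n => ψ n) s n‖ ≤ 2 * B / N := by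
  have hs' : 1 < (s:ℂ).re := by simpa using hs
  have hB0 : 0 ≤ B := (norm_nonneg _).trans (hB 0)
  rw [DirichletCharacter.LFunction_eq_LSeries ψ hs']
  have hsum := DirichletCharacter.LSeriesSummable_of_one_lt_re ψ hs'
  have ht := hsum.hasSum.tendsto_sum_nat
  have ht2 := (ht.sub_const (∑ n ∈ Finset.range N, LSeries.term (fun n => ψ n) s n)).norm
  apply le_of_tendsto ht2
  filter_upwards [eventually_ge_atTop N] with K hK
  rw [← Finset.sum_Ico_eq_sub _ hK]
  have e : ∑ n ∈ Finset.Ico N K, LSeries.term (fun n => ψ n) s n =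
      ∑ n ∈ Finset.Ico N K, (((n:ℝ) ^ (-s) : ℝ) : ℂ) * ψ n := by
    apply Finset.sum_congr rfl
    intro n hn
    have hn := (Finset.mem_Ico.1 hn).1
    rw [LSeries.term_of_ne_zero (by omega), Complex.ofReal_cpow (by positivity)]
    push_cast
    rw [Complex.cpow_neg]; ring
  rw [e]
  have hN' : (1:ℝ) ≤ N := by exact_mod_cast hN
  refine (abel_bound (fun n => (n:ℝ)^(-s)) (fun n => ψ n) K hK ?_ ?_ hB).trans ?_
  · intro n hn
    have : (0:ℝ) < n := by exact_mod_cast (by omega)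
    apply Real.rpow_le_rpow_of_nonpos this (by push_cast; linarith) (by linarith)
  · intro n hn; positivity
  · rw [div_eq_mul_inv]
    gcongr
    rw [← Real.rpow_neg_one]
    exact Real.rpow_le_rpow_of_exponent_le hN' (by linarith)

theorem trunc_one {M : ℕ} [NeZero M] {ψ : DirichletCharacter ℂ M} (hψ : ψ ≠ 1) {B : ℝ}
    (hB : ∀ t, ‖∑ i ∈ Finset.range t, ψ i‖ ≤ B) {N : ℕ} (hN : 1 ≤ N) :
    ‖ψ.LFunction 1 - ∑ n ∈ Finset.range N, ψ n / n‖ ≤ 2 * B / N := by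
  have hc : Continuous (fun s : ℝ => ψ.LFunction s - ∑ n ∈ Finset.range N, LSeries.term (fun n => ψ n) s n) := by
    apply Continuous.sub
    · exact (DirichletCharacter.differentiable_LFunction hψ).continuous.comp Complex.continuous_ofReal
    · apply continuous_finsetSum
      intro n _
      by_cases hn : n = 0
      · subst hn; simp only [LSeries.term_zero]; exact continuous_const
      · simp only [LSeries.term_of_ne_zero hn]
        have hn' : (n:ℂ) ≠ 0 := by exact_mod_cast hn
        apply Continuous.div continuous_const
        · exact Continuous.const_cpow Complex.continuous_ofReal (Or.inl hn')
        · intro s; simp [Complex.cpow_eq_zero_iff, hn']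
  have h1 := (hc.norm.tendsto 1).mono_left (nhdsWithin_le_nhds (s := Set.Ioi 1))
  have h2 : ‖ψ.LFunction ((1:ℝ):ℂ) - ∑ n ∈ Finset.range N, LSeries.term (fun n => ψ n) ((1:ℝ):ℂ) n‖ ≤ 2 * B / N := by
    apply le_of_tendsto h1
    filter_upwards [self_mem_nhdsWithin] with s hs
    exact trunc_s ψ hB hN hs
  rw [Complex.ofReal_one] at h2
  convert! h2 using 3
  apply Finset.sum_congr rfl
  intro n _
  by_cases hn : n = 0
  · subst hn; simp
  · rw [LSeries.term_of_ne_zero hn, Complex.cpow_one]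

theorem L_one_nonneg {M : ℕ} [NeZero M] {ψ : DirichletCharacter ℂ M} (hψ : ψ ≠ 1)
    (hq : MulChar.IsQuadratic ψ) : 0 ≤ (ψ.LFunction 1).re := by
  have hc : Continuous (fun s : ℝ => (ψ.LFunction s).re) :=
    Complex.continuous_re.comp
      ((DirichletCharacter.differentiable_LFunction hψ).continuous.comp Complex.continuous_ofReal)
  have h1 := (hc.tendsto 1).mono_left (nhdsWithin_le_nhds (s := Set.Ioi 1))
  rw [Complex.ofReal_one] at h1
  apply ge_of_tendsto h1
  filter_upwards [self_mem_nhdsWithin] with s hs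
  have hs : 1 < s := hs
  have hs' : 1 < (s:ℂ).re := by simpa using hs
  rw [DirichletCharacter.LFunction_eq_LSeries ψ hs']
  have ht := (Complex.continuous_re.tendsto _).comp (DirichletCharacter.LSeries_eulerProduct ψ hs')
  apply ge_of_tendsto ht
  filter_upwards with n
  have hval : ∀ p ∈ Nat.primesBelow n, ∃ r : ℝ, 0 ≤ r ∧ (1 - ψ p * (p : ℂ) ^ (-(s:ℂ)))⁻¹ = (r : ℂ) := by
    intro p hp
    have hp' := (Nat.mem_primesBelow.1 hp).2
    have hp1 : (1:ℝ) < p := by exact_mod_cast hp'.one_lt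
    have e : (p : ℂ) ^ (-(s:ℂ)) = (((p:ℝ) ^ (-s) : ℝ) : ℂ) := by
      rw [Complex.ofReal_cpow (by positivity)]; push_cast; rfl
    have hlt : (p:ℝ) ^ (-s) < 1 := Real.rpow_lt_one_of_one_lt_of_neg hp1 (by linarith)
    have hpos : 0 < (p:ℝ) ^ (-s) := by positivity
    rw [e]
    rcases hq p with h | h | h <;> rw [h]
    · exact ⟨1, by norm_num, by simp⟩
    · exact ⟨(1 - (p:ℝ) ^ (-s))⁻¹, by rw [inv_nonneg]; linarith, by push_cast; ring⟩
    · exact ⟨(1 + (p:ℝ) ^ (-s))⁻¹, by rw [inv_nonneg]; linarith, by push_cast; ring⟩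
  choose! r hr0 hr using hval
  show 0 ≤ (∏ p ∈ Nat.primesBelow n, (1 - ψ p * (p : ℂ) ^ (-(s:ℂ)))⁻¹).re
  rw [Finset.prod_congr rfl hr, ← Complex.ofReal_prod, Complex.ofReal_re]
  exact Finset.prod_nonneg hr0

end S7

namespace S7

open ArithmeticFunction in
lemma mu_sum {g : ℕ} (hg : g ≠ 0) :
    ∑ e ∈ g.divisors, ((moebius e : ℤ) : ℂ) = if g = 1 then 1 else 0 := by
  have h := congrArg (fun f : ArithmeticFunction ℤ => f g) coe_zeta_mul_moebius
  simp only [coe_zeta_mul_apply, one_apply] at h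
  have h2 := congrArg (fun z : ℤ => (z : ℂ)) h
  push_cast at h2
  exact h2

open ArithmeticFunction in
lemma coprime_sum {q : ℕ} (χ : DirichletCharacter ℂ q) {B : ℝ}
    (hB : ∀ t, ‖∑ i ∈ Finset.range t, χ i‖ ≤ B) {R : ℕ} (hR : R ≠ 0) (t : ℕ) :
    ‖∑ n ∈ Finset.range t, (if Nat.Coprime n R then χ n else 0)‖ ≤ R * B := by
  have hB0 : 0 ≤ B := (norm_nonneg _).trans (hB 0)
  have key : ∑ n ∈ Finset.range t, (if Nat.Coprime n R then χ n else 0) =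
      ∑ e ∈ R.divisors, ((moebius e : ℤ) : ℂ) * ∑ n ∈ (Finset.range t).filter (fun n => e ∣ n), χ n := by
    have h1 : ∀ n ∈ Finset.range t, (if Nat.Coprime n R then χ n else 0) =
        ∑ e ∈ R.divisors, if e ∣ n then ((moebius e : ℤ) : ℂ) * χ n else 0 := by
      intro n _
      have h2 := mu_sum (g := Nat.gcd n R) (Nat.gcd_ne_zero_right hR)
      have h3 : (Nat.gcd n R).divisors = R.divisors.filter (fun e => e ∣ n) := by
        ext e
        simp only [Nat.mem_divisors, Finset.mem_filter, Nat.dvd_gcd_iff]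
        have := Nat.gcd_ne_zero_right (m := n) hR
        tauto
      rw [h3, Finset.sum_filter] at h2
      have h4 : ∑ e ∈ R.divisors, (if e ∣ n then ((moebius e : ℤ) : ℂ) * χ n else 0) =
          (∑ e ∈ R.divisors, if e ∣ n then ((moebius e : ℤ) : ℂ) else 0) * χ n := by
        rw [Finset.sum_mul]
        apply Finset.sum_congr rfl
        intro e _
        split_ifs <;> simp
      rw [h4, h2]
      unfold Nat.Coprime
      split_ifs <;> simp
    rw [Finset.sum_congr rfl h1, Finset.sum_comm]
    apply Finset.sum_congr rfl
    intro e _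
    rw [Finset.mul_sum, Finset.sum_filter]
  rw [key]
  calc _ ≤ ∑ e ∈ R.divisors, B := by
        apply norm_sum_le_of_le
        intro e he
        have he0 : 0 < e := Nat.pos_of_mem_divisors he
        have h5 : ∑ n ∈ (Finset.range t).filter (fun n => e ∣ n), χ n =
            χ e * ∑ m ∈ Finset.range ((t + e - 1) / e), χ m := by
          rw [Finset.mul_sum]
          symm
          apply Finset.sum_bij (fun m _ => e * m)
          · intro m hm
            rw [Finset.mem_range, Nat.lt_iff_add_one_le, Nat.le_div_iff_mul_le he0] at hm
            rw [Finset.mem_filter, Finset.mem_range]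
            refine ⟨?_, dvd_mul_right _ _⟩
            rw [add_mul, mul_comm] at hm; omega
          · intro a _ b _ hab
            exact Nat.eq_of_mul_eq_mul_left he0 hab
          · intro n hn
            rw [Finset.mem_filter, Finset.mem_range] at hn
            obtain ⟨hn, m, rfl⟩ := hn
            refine ⟨m, ?_, rfl⟩
            rw [Finset.mem_range, Nat.lt_iff_add_one_le, Nat.le_div_iff_mul_le he0, add_mul, mul_comm]
            omega
          · intro m _
            push_cast
            rw [map_mul]
        rw [h5, norm_mul, norm_mul]
        have h6 : ‖((moebius e : ℤ) : ℂ)‖ ≤ 1 := by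
          rcases moebius_eq_or e with h | h | h <;> simp [h]
        have h7 := χ.norm_le_one (e : ZMod q)
        have h8 := hB ((t + e - 1) / e)
        calc _ ≤ 1 * (1 * B) := by gcongr
          _ = B := by ring
    _ = (R.divisors.card : ℝ) * B := by simp
    _ ≤ R * B := by
        gcongr
        exact_mod_cast Nat.card_divisors_le_self R

theorem Rv_exists {d P : ℕ} [NeZero d] (hd : d % 8 = 5) (hP : P ≠ 0) :
    ∃ r : ℝ, 0 ≤ r ∧
      (∀ N : ℕ, 1 ≤ N → |r - ∑ n ∈ Finset.range N,
        (if Nat.Coprime n P then ((jacobiSym n d : ℤ) : ℝ) / n else 0)| ≤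
          2 * (P * (√d * (1 + Real.log d))) / N) ∧
      (Squarefree d → ∃ χ : DirichletCharacter ℂ d, χ.IsPrimitive ∧ MulChar.IsQuadratic χ ∧
        (χ.LFunction 1).re * ∏ p ∈ P.primeFactors, (1 - ((jacobiSym p d : ℤ) : ℝ) / p) = r) := by
  obtain ⟨f, b, hbf, hf⟩ := Nat.sq_mul_squarefree d
  have hf0 : f ≠ 0 := hf.ne_zero
  have hb0 : b ≠ 0 := by rintro rfl; simp at hbf; exact NeZero.ne d hbf.symm
  have : NeZero f := ⟨hf0⟩
  have hdodd : Odd d := by rw [Nat.odd_iff]; omega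
  have hfodd : Odd f := by rw [← hbf] at hdodd; exact (Nat.odd_mul.1 hdodd).2
  have hbodd : Odd b := by
    rw [← hbf] at hdodd; exact Nat.Odd.of_mul_left (by rw [pow_two, mul_assoc] at hdodd; exact hdodd)
  have hf1 : 1 < f := by
    by_contra h
    have hf1 : f = 1 := by omega
    rw [hf1, mul_one] at hbf
    have : b % 8 = 1 ∨ b % 8 = 3 ∨ b % 8 = 5 ∨ b % 8 = 7 := by
      rw [Nat.odd_iff] at hbodd; omega
    rw [← hbf, Nat.pow_mod] at hd
    rcases this with h | h | h | h <;> rw [h] at hd <;> norm_num at hd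
  have hprim := jc_primitive hfodd hf
  have hne : jc f ≠ 1 := by
    intro h
    rw [DirichletCharacter.isPrimitive_def, h, DirichletCharacter.conductor_one] at hprim
    omega
  set M := f * (b * P) with hM
  have hM0 : M ≠ 0 := by positivity
  have : NeZero M := ⟨hM0⟩
  have hdvd : f ∣ M := ⟨_, rfl⟩
  set ψ := DirichletCharacter.changeLevel hdvd (jc f) with hψ
  have hψne : ψ ≠ 1 := by
    rw [hψ, Ne, DirichletCharacter.changeLevel_eq_one_iff]; exact hne
  have hψval : ∀ n : ℕ, ψ n = if Nat.Coprime n (b * P) then jc f n else 0 := by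
    intro n
    by_cases hc : Nat.Coprime n M
    · have h1 := DirichletCharacter.changeLevel_eq_cast_of_dvd' (jc f) hdvd
        (Nat.isCoprime_iff_coprime.2 hc)
      rw [if_pos (Nat.Coprime.coprime_dvd_right ⟨f, by rw [hM]; ring⟩ hc)]
      simpa using h1
    · have h1 : ψ (n : ZMod M) = 0 := MulChar.map_nonunit _ (by rwa [ZMod.isUnit_iff_coprime])
      rw [h1]
      split_ifs with h2
      · symm
        apply MulChar.map_nonunit
        rw [ZMod.isUnit_iff_coprime]
        intro h3
        exact hc (Nat.Coprime.mul_right h3 h2)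
      · rfl
  have hψq : MulChar.IsQuadratic ψ := by
    intro a
    rw [← ZMod.natCast_zmod_val a, hψval]
    split_ifs
    · exact jc_quadratic f _
    · left; rfl
  have hdf : (d:ℝ) = b^2 * f := by rw [← hbf]; push_cast; ring
  have hfd : (f:ℝ) ≤ d := by
    have : f ≤ d := Nat.le_of_dvd (Nat.pos_of_ne_zero (NeZero.ne d)) ⟨b^2, by rw [← hbf]; ring⟩
    exact_mod_cast this
  have hf1' : (1:ℝ) < f := by exact_mod_cast hf1
  have hBψ : ∀ t, ‖∑ i ∈ Finset.range t, ψ i‖ ≤ P * (√d * (1 + Real.log d)) := by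
    intro t
    simp_rw [hψval]
    refine (coprime_sum (jc f) (polya hf1 hprim (jc_quadratic f)) (by positivity) t).trans ?_
    have hs : √(d:ℝ) = b * √f := by
      rw [hdf, Real.sqrt_mul (by positivity), Real.sqrt_sq (by positivity)]
    rw [hs]
    push_cast
    have hl : Real.log f ≤ Real.log d := Real.log_le_log (by linarith) hfd
    have hl0 : 0 ≤ Real.log f := Real.log_nonneg hf1'.le
    calc (b:ℝ) * P * (√f * (1 + Real.log f)) ≤ (b:ℝ) * P * (√f * (1 + Real.log d)) := by gcongr
      _ = _ := by ring
  refine ⟨(ψ.LFunction 1).re, L_one_nonneg hψne hψq, ?_, ?_⟩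
  · intro N hN
    have h := trunc_one hψne hBψ hN
    refine le_trans ?_ h
    refine le_trans (le_of_eq ?_) (Complex.abs_re_le_norm _)
    rw [Complex.sub_re, Complex.re_sum]
    congr 2
    apply Finset.sum_congr rfl
    intro n _
    rw [hψval, jc_apply]
    have hJ : jacobiSym n d = jacobiSym n b ^ 2 * jacobiSym n f := by
      rw [← hbf, jacobiSym.mul_right' _ (by positivity) hf0, jacobiSym.pow_right]
    by_cases hnP : Nat.Coprime n P
    · by_cases hnb : Nat.Coprime n b
      · rw [if_pos hnP, if_pos (Nat.Coprime.mul_right hnb hnP), hJ]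
        have : jacobiSym n b ^ 2 = 1 := jacobiSym.sq_one hnb
        rw [this, one_mul, Complex.div_natCast_re]
        simp
      · rw [if_pos hnP, if_neg (fun h => hnb (Nat.Coprime.coprime_mul_right_right h)), hJ]
        have : jacobiSym n b = 0 := by
          by_contra h0
          exact hnb ((coprime_of_jacobi hb0).1 h0)
        rw [this]; simp
    · rw [if_neg hnP, if_neg (fun h => hnP (Nat.Coprime.coprime_mul_left_right h))]
      simp
  · intro hsq
    have hb1 : b = 1 := by
      have := hsq b ⟨f, by rw [← hbf]; ring⟩
      exact Nat.isUnit_iff.1 this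
    subst hb1
    obtain rfl : f = d := by rw [← hbf]; simp
    refine ⟨jc f, hprim, jc_quadratic f, ?_⟩
    rw [hψ, DirichletCharacter.LFunction_changeLevel hdvd (jc f) (Or.inl hne)]
    have e1 : ∀ p ∈ M.primeFactors, (1 - jc f p * (p:ℂ) ^ (-(1:ℂ))) =
        ((1 - ((jacobiSym p f : ℤ) : ℝ) / p : ℝ) : ℂ) := by
      intro p _
      rw [jc_apply, Complex.cpow_neg_one]
      push_cast; ring
    rw [Finset.prod_congr rfl e1, ← Complex.ofReal_prod, Complex.re_mul_ofReal]
    congr 1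
    apply Finset.prod_subset
    · apply Nat.primeFactors_mono ⟨f * 1, by rw [hM]; ring⟩ hM0
    · intro p hp hp2
      have hpp := Nat.prime_of_mem_primeFactors hp
      have hpM := Nat.dvd_of_mem_primeFactors hp
      have hpf : p ∣ f := by
        rcases (Nat.Prime.dvd_mul hpp).1 hpM with h | h
        · exact h
        · exact absurd (Nat.mem_primeFactors.2 ⟨hpp, by simpa using h, hP⟩) hp2
      have : jacobiSym p f = 0 := by
        by_contra h0
        have := (coprime_of_jacobi hf0).1 h0
        exact hpp.one_lt.ne' (Nat.Coprime.eq_one_of_dvd this hpf)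
      rw [this]; simp

end S7

namespace S7

/-- primes up to `y` -/
def PS (y : ℕ) : Finset ℕ := (Finset.Ioc 0 y).filter Nat.Prime

/-- product of the primes up to `y` -/
def PP (y : ℕ) : ℕ := ∏ p ∈ PS y, p

lemma mem_PS {y p : ℕ} : p ∈ PS y ↔ p.Prime ∧ p ≤ y := by
  unfold PS
  simp only [Finset.mem_filter, Finset.mem_Ioc]
  constructor
  · rintro ⟨⟨_, h⟩, h2⟩; exact ⟨h2, h⟩
  · rintro ⟨h1, h2⟩; exact ⟨⟨h1.pos, h2⟩, h1⟩

lemma PP_primeFactors (y : ℕ) : (PP y).primeFactors = PS y :=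
  Nat.primeFactors_prod (fun _ hp => (mem_PS.1 hp).1)

lemma PP_ne_zero (y : ℕ) : PP y ≠ 0 :=
  Finset.prod_ne_zero_iff.2 (fun _ hp => (mem_PS.1 hp).1.ne_zero)

lemma dvd_PP {y p : ℕ} (hp : p.Prime) (h : p ≤ y) : p ∣ PP y :=
  Finset.dvd_prod_of_mem (fun p => p) (mem_PS.2 ⟨hp, h⟩)

lemma PP_le (y : ℕ) : PP y ≤ 4 ^ y := by
  have h := primorial_le_four_pow y
  have e : PP y = primorial y := by
    unfold PP primorial
    apply Finset.prod_congr _ (fun _ _ => rfl)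
    ext p
    simp only [mem_PS, Finset.mem_filter, Finset.mem_range]
    constructor
    · rintro ⟨h1, h2⟩; exact ⟨by omega, h1⟩
    · rintro ⟨h1, h2⟩; exact ⟨h2, by omega⟩
  omega

lemma class_aux (S : Finset ℕ) (hS : ∀ p ∈ S, p.Prime ∧ p ≠ 2) :
    ∃ a : ℕ, a % 8 = 5 ∧ ∀ p ∈ S, jacobiSym a p = -1 := by
  classical
  induction S using Finset.induction_on with
  | empty => exact ⟨5, rfl, by simp⟩
  | insert p S hpS ih =>
    obtain ⟨a, ha, haS⟩ := ih (fun q hq => hS q (Finset.mem_insert_of_mem hq))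
    obtain ⟨hp, hp2⟩ := hS p (Finset.mem_insert_self _ _)
    obtain ⟨r, hr⟩ := exists_nonres hp hp2
    have hcop : Nat.Coprime (8 * ∏ q ∈ S, q) p := by
      apply Nat.Coprime.mul_left
      · rw [show 8 = 2 ^ 3 by norm_num]
        apply Nat.Coprime.pow_left
        exact (Nat.coprime_primes Nat.prime_two hp).2 hp2.symm
      · apply Nat.Coprime.prod_left
        intro q hq
        apply (Nat.coprime_primes (hS q (Finset.mem_insert_of_mem hq)).1 hp).2
        rintro rfl; exact hpS hq
    obtain ⟨x, hx1, hx2⟩ := Nat.chineseRemainder hcop a r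
    refine ⟨x, ?_, ?_⟩
    · have : x ≡ a [MOD 8] := hx1.of_dvd ⟨_, rfl⟩
      rw [Nat.ModEq] at this; omega
    · intro q hq
      rcases Finset.mem_insert.1 hq with rfl | hq
      · rw [jacobi_congr hx2, hr]
      · have : x ≡ a [MOD q] := hx1.of_dvd ((Finset.dvd_prod_of_mem (fun p => p) hq).mul_left _)
        rw [jacobi_congr this, haS q hq]

lemma exists_class {y : ℕ} (hy : 2 ≤ y) :
    ∃ a : ℕ, a < 4 * PP y ∧ ∀ j : ℕ, (a + 4 * PP y * j) % 8 = 5 ∧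
      ∀ p ∈ PS y, jacobiSym p (a + 4 * PP y * j) = -1 := by
  obtain ⟨a, ha, haS⟩ := class_aux ((PS y).erase 2) (fun p hp =>
    ⟨(mem_PS.1 (Finset.mem_of_mem_erase hp)).1, Finset.ne_of_mem_erase hp⟩)
  have hPpos : 0 < PP y := Nat.pos_of_ne_zero (PP_ne_zero y)
  have h8 : 8 ∣ 4 * PP y := by
    obtain ⟨k, hk⟩ := dvd_PP Nat.prime_two hy
    exact ⟨k, by rw [hk]; ring⟩
  refine ⟨a % (4 * PP y), Nat.mod_lt _ (by omega), ?_⟩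
  intro j
  set d := a % (4 * PP y) + 4 * PP y * j with hd
  have hmod : d ≡ a [MOD 4 * PP y] := by
    rw [hd]
    simp [Nat.ModEq]
  have hd8 : d % 8 = 5 := by
    have : d ≡ a [MOD 8] := hmod.of_dvd h8
    rw [Nat.ModEq] at this; omega
  refine ⟨hd8, ?_⟩
  intro p hp
  obtain ⟨hpp, hpy⟩ := mem_PS.1 hp
  by_cases hp2 : p = 2
  · subst hp2
    have := jacobiSym.at_two (b := d) (by rw [Nat.odd_iff]; omega)
    rw [ZMod.χ₈_nat_eq_if_mod_eight] at this
    rw [if_neg (by omega), if_neg (by omega)] at this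
    exact_mod_cast this
  · rw [jacobiSym.quadratic_reciprocity_one_mod_four' (hpp.odd_of_ne_two hp2) (by omega)]
    have : d ≡ a [MOD p] := hmod.of_dvd ((dvd_PP hpp hpy).mul_left _)
    rw [jacobi_congr this]
    exact haS p (Finset.mem_erase.2 ⟨hp2, hp⟩)

lemma ap_count {m Q a : ℕ} (hm : 0 < m) (hc : Nat.Coprime m Q) (J : ℕ) :
    (((Finset.range J).filter (fun j => m ∣ a + Q * j)).card : ℝ) ≤ J / m + 1 := by
  rcases Finset.eq_empty_or_nonempty ((Finset.range J).filter (fun j => m ∣ a + Q * j)) with h | ⟨v, hv⟩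
  · rw [h]; simp; positivity
  · have hsub : (Finset.range J).filter (fun j => m ∣ a + Q * j) ⊆
        (Finset.range J).filter (fun j => j ≡ v [MOD m]) := by
      intro j hj
      rw [Finset.mem_filter] at hj hv ⊢
      refine ⟨hj.1, ?_⟩
      have h1 : a + Q * j ≡ a + Q * v [MOD m] :=
        ((Nat.modEq_zero_iff_dvd).2 hj.2).trans ((Nat.modEq_zero_iff_dvd).2 hv.2).symm
      exact Nat.ModEq.cancel_left_of_coprime hc (Nat.ModEq.add_left_cancel' a h1)
    have h2 := Finset.card_le_card hsub
    rw [← Nat.count_eq_card_filter_range (fun j => j ≡ v [MOD m]), Nat.count_modEq_card J hm] at h2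
    have h3 : ((Finset.range J).filter (fun j => m ∣ a + Q * j)).card ≤ J / m + 1 := by
      refine h2.trans ?_
      split_ifs <;> omega
    calc _ ≤ ((J / m + 1 : ℕ) : ℝ) := by exact_mod_cast h3
      _ ≤ _ := by push_cast; gcongr; exact Nat.cast_div_le

lemma big_of_coprime {y k : ℕ} (hk : Nat.Coprime k (PP y)) (hk0 : k ≠ 0) : k = 1 ∨ y < k := by
  by_contra h
  push Not at h
  obtain ⟨p, hp, hpk⟩ := Nat.exists_prime_and_dvd h.1
  have hpy : p ≤ y := (Nat.le_of_dvd (Nat.pos_of_ne_zero hk0) hpk).trans h.2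
  have := Nat.Coprime.coprime_dvd_left hpk hk
  exact hp.one_lt.ne' (Nat.Coprime.eq_one_of_dvd this (dvd_PP hp hpy))

lemma sum_inv_sq {y S : ℕ} (hy : 1 ≤ y) : ∑ i ∈ Finset.Ioc y S, ((i:ℝ) ^ 2)⁻¹ ≤ (y:ℝ)⁻¹ := by
  by_cases h : y ≤ S
  · refine (sum_Ioc_inv_sq_le_sub (by omega) h).trans ?_
    have : (0:ℝ) ≤ (S:ℝ)⁻¹ := by positivity
    linarith
  · rw [Finset.Ioc_eq_empty (by omega)]; simp

lemma nonsq_count {y a J X : ℕ} (hy : 2 ≤ y)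
    (ha : ∀ j : ℕ, (a + 4 * PP y * j) % 8 = 5 ∧ ∀ p ∈ PS y, jacobiSym p (a + 4 * PP y * j) = -1)
    (hX : ∀ j < J, a + 4 * PP y * j ≤ X) :
    (((Finset.range J).filter (fun j => ¬ Squarefree (a + 4 * PP y * j))).card : ℝ) ≤
      J / y + Nat.sqrt X := by
  classical
  have hsub : (Finset.range J).filter (fun j => ¬ Squarefree (a + 4 * PP y * j)) ⊆
      ((Finset.Ioc y (Nat.sqrt X)).filter Nat.Prime).biUnion
        (fun p => (Finset.range J).filter (fun j => p ^ 2 ∣ a + 4 * PP y * j)) := by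
    intro j hj
    rw [Finset.mem_filter, Finset.mem_range] at hj
    obtain ⟨hjJ, hns⟩ := hj
    rw [Nat.squarefree_iff_prime_squarefree] at hns
    push Not at hns
    obtain ⟨p, hp, hpd⟩ := hns
    have hd0 : a + 4 * PP y * j ≠ 0 := by have := (ha j).1; omega
    rw [Finset.mem_biUnion]
    refine ⟨p, ?_, ?_⟩
    · rw [Finset.mem_filter, Finset.mem_Ioc]
      refine ⟨⟨?_, ?_⟩, hp⟩
      · by_contra hle
        push Not at hle
        have h1 := (ha j).2 p (mem_PS.2 ⟨hp, hle⟩)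
        have h2 := (coprime_of_jacobi hd0).1 (by rw [h1]; norm_num)
        exact hp.one_lt.ne' (Nat.Coprime.eq_one_of_dvd h2 ((dvd_mul_right p p).trans hpd))
      · rw [Nat.le_sqrt]
        exact (Nat.le_of_dvd (Nat.pos_of_ne_zero hd0) hpd).trans (hX j hjJ)
    · rw [Finset.mem_filter, Finset.mem_range, pow_two]
      exact ⟨hjJ, hpd⟩
  have h1 := (Finset.card_le_card hsub).trans Finset.card_biUnion_le
  have hy1 : 1 ≤ y := by omega
  calc _ ≤ ((∑ p ∈ (Finset.Ioc y (Nat.sqrt X)).filter Nat.Prime,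
        ((Finset.range J).filter (fun j => p ^ 2 ∣ a + 4 * PP y * j)).card : ℕ) : ℝ) := by
        exact_mod_cast h1
    _ ≤ ∑ p ∈ (Finset.Ioc y (Nat.sqrt X)).filter Nat.Prime, ((J:ℝ) * ((p:ℝ) ^ 2)⁻¹ + 1) := by
        push_cast
        apply Finset.sum_le_sum
        intro p hp
        rw [Finset.mem_filter, Finset.mem_Ioc] at hp
        have hcop : Nat.Coprime (p ^ 2) (4 * PP y) := by
          apply Nat.Coprime.pow_left
          rw [Nat.Prime.coprime_iff_not_dvd hp.2]
          intro hdv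
          rcases (Nat.Prime.dvd_mul hp.2).1 hdv with h | h
          · rw [show 4 = 2 ^ 2 by norm_num] at h
            have := Nat.le_of_dvd (by norm_num) (hp.2.dvd_of_dvd_pow h)
            omega
          · have : p ∈ (PP y).primeFactors := Nat.mem_primeFactors.2 ⟨hp.2, h, PP_ne_zero y⟩
            rw [PP_primeFactors] at this
            have := (mem_PS.1 this).2
            omega
        have := ap_count (a := a) (pow_pos hp.2.pos 2) hcop J
        push_cast at this
        rw [← div_eq_mul_inv]
        exact this
    _ ≤ ∑ p ∈ Finset.Ioc y (Nat.sqrt X), ((J:ℝ) * ((p:ℝ) ^ 2)⁻¹ + 1) := by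
        apply Finset.sum_le_sum_of_subset_of_nonneg (Finset.filter_subset _ _)
        intros; positivity
    _ = J * (∑ p ∈ Finset.Ioc y (Nat.sqrt X), ((p:ℝ) ^ 2)⁻¹) + ((Nat.sqrt X - y : ℕ) : ℝ) := by
        rw [Finset.sum_add_distrib, Finset.mul_sum]; simp
    _ ≤ J / y + Nat.sqrt X := by
        rw [div_eq_mul_inv]
        gcongr
        · exact sum_inv_sq hy1
        · omega

lemma squares_sum {y N : ℕ} (hy : 1 ≤ y) :
    ∑ n ∈ (Finset.range N).filter (fun n => Nat.Coprime n (PP y) ∧ IsSquare n ∧ n ≠ 0), ((n:ℝ))⁻¹ ≤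
      1 + (y:ℝ)⁻¹ := by
  classical
  have hsub : (Finset.range N).filter (fun n => Nat.Coprime n (PP y) ∧ IsSquare n ∧ n ≠ 0) ⊆
      (insert 1 (Finset.Ioc y N)).image (fun k : ℕ => k ^ 2) := by
    intro n hn
    rw [Finset.mem_filter, Finset.mem_range] at hn
    obtain ⟨hnN, hc, ⟨k, rfl⟩, hn0⟩ := hn
    rw [Finset.mem_image]
    refine ⟨k, ?_, by ring⟩
    have hk0 : k ≠ 0 := by rintro rfl; simp at hn0
    have hkc : Nat.Coprime k (PP y) := Nat.Coprime.coprime_mul_left hc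
    rw [Finset.mem_insert, Finset.mem_Ioc]
    rcases big_of_coprime hkc hk0 with h | h
    · left; exact h
    · right
      refine ⟨h, ?_⟩
      have : k * 1 ≤ k * k := Nat.mul_le_mul_left _ (by omega)
      omega
  calc _ ≤ ∑ n ∈ ((insert 1 (Finset.Ioc y N)).image (fun k : ℕ => k ^ 2) : Finset ℕ), ((n:ℕ):ℝ)⁻¹ := by
        apply Finset.sum_le_sum_of_subset_of_nonneg hsub
        intros; positivity
    _ = ∑ k ∈ insert 1 (Finset.Ioc y N), ((k:ℝ) ^ 2)⁻¹ := by
        rw [Finset.sum_image]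
        · push_cast; rfl
        · intro a _ b _ h
          exact Nat.pow_left_injective (n := 2) (by norm_num) h
    _ ≤ 1 + (y:ℝ)⁻¹ := by
        rw [Finset.sum_insert (by simp; omega)]
        have := sum_inv_sq (S := N) hy
        simp only [Nat.cast_one, one_pow, inv_one]
        linarith

lemma T_sum {y a J N : ℕ} (hy : 2 ≤ y)
    (ha : ∀ j : ℕ, (a + 4 * PP y * j) % 8 = 5) :
    ∑ j ∈ Finset.range J, ∑ n ∈ Finset.range N,
        (if Nat.Coprime n (PP y) then ((jacobiSym n (a + 4 * PP y * j) : ℤ) : ℝ) / n else 0) ≤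
      J * (1 + (y:ℝ)⁻¹) + N := by
  classical
  rw [Finset.sum_comm]
  have hterm : ∀ n ∈ Finset.range N, ∑ j ∈ Finset.range J,
      (if Nat.Coprime n (PP y) then ((jacobiSym n (a + 4 * PP y * j) : ℤ) : ℝ) / n else 0) ≤
      (if Nat.Coprime n (PP y) ∧ IsSquare n ∧ n ≠ 0 then (J:ℝ) * (n:ℝ)⁻¹ else 0) + 1 := by
    intro n _
    by_cases hc : Nat.Coprime n (PP y)
    · rw [Finset.sum_congr rfl (fun j _ => if_pos hc)]
      have h2 : 2 ∣ PP y := dvd_PP Nat.prime_two hy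
      have hodd : Odd n := by
        rw [← Nat.not_even_iff_odd, even_iff_two_dvd]
        intro h
        have := Nat.dvd_gcd h h2
        rw [hc] at this; omega
      have hn0 : n ≠ 0 := by rintro rfl; simp at hodd
      have hn' : (0:ℝ) < n := by exact_mod_cast Nat.pos_of_ne_zero hn0
      rw [← Finset.sum_div]
      have hrec : ∀ j, jacobiSym n (a + 4 * PP y * j) = jacobiSym ((a + 4 * PP y * j : ℕ) : ℤ) n := by
        intro j
        exact jacobiSym.quadratic_reciprocity_one_mod_four' hodd (by have := ha j; omega)
      by_cases hs : IsSquare n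
      · rw [if_pos ⟨hc, hs, hn0⟩]
        have : ∑ j ∈ Finset.range J, ((jacobiSym n (a + 4 * PP y * j) : ℤ) : ℝ) ≤ J := by
          calc _ ≤ ∑ j ∈ Finset.range J, (1:ℝ) :=
                Finset.sum_le_sum (fun j _ => (le_abs_self _).trans (jacobi_abs_le _ _))
            _ = J := by simp
        rw [← div_eq_mul_inv]
        have : (∑ j ∈ Finset.range J, ((jacobiSym n (a + 4 * PP y * j) : ℤ) : ℝ)) / n ≤ J / n := by gcongr
        linarith
      · rw [if_neg (fun h => hs h.2.1), zero_add]
        simp_rw [hrec]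
        rw [div_le_one hn']
        have hcop : Nat.Coprime (4 * PP y) n := by
          apply Nat.Coprime.mul_left
          · rw [show 4 = 2 ^ 2 by norm_num]
            exact Nat.Coprime.pow_left _ (Nat.coprime_two_left.2 hodd)
          · exact hc.symm
        exact (le_abs_self _).trans (jacobi_ap_sum hodd hs hcop J)
    · simp [hc]
  refine (Finset.sum_le_sum hterm).trans ?_
  rw [Finset.sum_add_distrib, ← Finset.sum_filter, ← Finset.mul_sum]
  have := squares_sum (N := N) (y := y) (by omega)
  simp only [Finset.sum_const, Finset.card_range, nsmul_eq_mul, mul_one]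
  gcongr

/-- good discriminants -/
def Good (y d : ℕ) : Prop := d % 4 = 1 ∧ Squarefree d ∧ ∃ (_ : NeZero d) (χ : DirichletCharacter ℂ d),
  χ.IsPrimitive ∧ MulChar.IsQuadratic χ ∧
    (χ.LFunction 1).re * ∏ p ∈ PS y, (1 + 1 / (p:ℝ)) ≤ 1 + 9 / y

open Classical in
theorem count_good {y X J N : ℕ} (hy : 9 ≤ y) (hJ : J = X / (4 * PP y)) (hN : N = J / y)
    (hN1 : 1 ≤ N) (h1 : (Nat.sqrt X : ℝ) * y ≤ J)
    (h2 : 2 * (PP y * (√X * (1 + Real.log X))) * y ≤ N) :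
    (J:ℝ) / y ≤ (((Finset.range (X+1)).filter (Good y)).card : ℝ) := by
  obtain ⟨a, haQ, ha⟩ := exists_class (y := y) (by omega)
  have hPpos : 0 < PP y := Nat.pos_of_ne_zero (PP_ne_zero y)
  have hX : ∀ j < J, a + 4 * PP y * j ≤ X := by
    intro j hj
    have : 4 * PP y * (j + 1) ≤ 4 * PP y * J := Nat.mul_le_mul_left _ hj
    have h3 : 4 * PP y * J ≤ X := by rw [hJ]; exact Nat.mul_div_le _ _
    rw [mul_add] at this
    omega
  have hy' : (9:ℝ) ≤ y := by exact_mod_cast hy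
  have hN' : (1:ℝ) ≤ N := by exact_mod_cast hN1
  have hr : ∀ j, ∃ r : ℝ, 0 ≤ r ∧
      (j < J → r ≤ (∑ n ∈ Finset.range N, (if Nat.Coprime n (PP y) then
        ((jacobiSym n (a + 4 * PP y * j) : ℤ) : ℝ) / n else 0)) + (y:ℝ)⁻¹) ∧
      (Squarefree (a + 4 * PP y * j) → r ≤ 1 + 9 / y → Good y (a + 4 * PP y * j)) := by
    intro j
    have hd8 := (ha j).1
    have hd0 : a + 4 * PP y * j ≠ 0 := by omega
    have : NeZero (a + 4 * PP y * j) := ⟨hd0⟩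
    obtain ⟨r, hr0, hr1, hr2⟩ := Rv_exists hd8 (PP_ne_zero y)
    refine ⟨r, hr0, ?_, ?_⟩
    · intro hj
      have h3 := hr1 N hN1
      have h4 := (le_abs_self _).trans h3
      set d := a + 4 * PP y * j with hd
      have hdX : (d:ℝ) ≤ X := by exact_mod_cast hX j hj
      have hd1 : (1:ℝ) ≤ d := by exact_mod_cast Nat.pos_of_ne_zero hd0
      have h5 : 2 * (PP y * (√d * (1 + Real.log d))) / N ≤ (y:ℝ)⁻¹ := by
        have hl : Real.log d ≤ Real.log X := Real.log_le_log (by linarith) hdX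
        have hl0 : 0 ≤ Real.log d := Real.log_nonneg hd1
        calc _ ≤ 2 * (PP y * (√X * (1 + Real.log X))) / N := by gcongr
          _ ≤ _ := by
            rw [div_le_iff₀ (by linarith), inv_mul_eq_div, le_div_iff₀ (by linarith)]
            exact h2
      linarith
    · intro hsq hle
      obtain ⟨χ, hχ1, hχ2, hχ3⟩ := hr2 hsq
      refine ⟨by omega, hsq, inferInstance, χ, hχ1, hχ2, ?_⟩
      rw [PP_primeFactors] at hχ3
      rw [← hχ3] at hle
      refine le_trans (le_of_eq ?_) hle
      congr 1
      apply Finset.prod_congr rfl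
      intro p hp
      rw [(ha j).2 p hp]
      push_cast; ring
  choose r hr0 hr1 hr2 using hr
  set G := (Finset.range J).filter (fun j => Good y (a + 4 * PP y * j)) with hG
  set A := (Finset.range J).filter (fun j => Squarefree (a + 4 * PP y * j)) with hA
  have hGA : G ⊆ A := by
    intro j hj
    rw [hG, Finset.mem_filter] at hj
    rw [hA, Finset.mem_filter]
    exact ⟨hj.1, hj.2.2.1⟩
  -- transfer to the final count
  have hinj : G.card ≤ ((Finset.range (X+1)).filter (Good y)).card := by
    apply Finset.card_le_card_of_injOn (fun j => a + 4 * PP y * j)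
    · intro j hj
      have hj : j ∈ G := hj
      rw [hG, Finset.mem_filter, Finset.mem_range] at hj
      simp only [Finset.coe_filter, Finset.mem_range, Set.mem_ofPred_eq]
      exact ⟨by have := hX j hj.1; omega, hj.2⟩
    · intro i _ j _ hij
      have : 4 * PP y * i = 4 * PP y * j := by simpa using hij
      exact Nat.eq_of_mul_eq_mul_left (by omega) this
  refine le_trans ?_ (by exact_mod_cast hinj : (G.card : ℝ) ≤ _)
  -- number of squarefree
  have hAcard : (J:ℝ) - (J / y + Nat.sqrt X) ≤ A.card := by
    have h3 := nonsq_count (X := X) (by omega) ha hX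
    have h4 := Finset.card_filter_add_card_filter_not (s := Finset.range J)
      (fun j => Squarefree (a + 4 * PP y * j))
    rw [Finset.card_range] at h4
    have h5 : (A.card : ℝ) + (((Finset.range J).filter (fun j => ¬ Squarefree (a + 4 * PP y * j))).card : ℝ) = J := by
      exact_mod_cast h4
    linarith
  have hupper : ∑ j ∈ Finset.range J, r j ≤ J * (1 + (y:ℝ)⁻¹) + N + J * (y:ℝ)⁻¹ := by
    calc _ ≤ ∑ j ∈ Finset.range J, ((∑ n ∈ Finset.range N, (if Nat.Coprime n (PP y) then
        ((jacobiSym n (a + 4 * PP y * j) : ℤ) : ℝ) / n else 0)) + (y:ℝ)⁻¹) :=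
          Finset.sum_le_sum (fun j hj => hr1 j (Finset.mem_range.1 hj))
      _ ≤ _ := by
          rw [Finset.sum_add_distrib]
          have := T_sum (y := y) (a := a) (J := J) (N := N) (by omega) (fun j => (ha j).1)
          simp only [Finset.sum_const, Finset.card_range, nsmul_eq_mul]
          linarith
  have hlower : (1 + 9 / (y:ℝ)) * (A.card - G.card) ≤ ∑ j ∈ Finset.range J, r j := by
    have h3 : ((A \ G).card : ℝ) = A.card - G.card := by
      rw [Finset.card_sdiff_of_subset hGA, Nat.cast_sub (Finset.card_le_card hGA)]
    calc _ = ∑ j ∈ A \ G, (1 + 9 / (y:ℝ)) := by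
          rw [Finset.sum_const, nsmul_eq_mul, h3]; ring
      _ ≤ ∑ j ∈ A \ G, r j := by
          apply Finset.sum_le_sum
          intro j hj
          rw [Finset.mem_sdiff] at hj
          obtain ⟨hjA, hjG⟩ := hj
          rw [hA, Finset.mem_filter] at hjA
          by_contra hlt
          push Not at hlt
          apply hjG
          rw [hG, Finset.mem_filter]
          exact ⟨hjA.1, hr2 j hjA.2 hlt.le⟩
      _ ≤ _ := by
          apply Finset.sum_le_sum_of_subset_of_nonneg
          · exact Finset.sdiff_subset.trans (Finset.filter_subset _ _)
          · intro j _ _; exact hr0 j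
  -- arithmetic
  set u := (y:ℝ)⁻¹ with hu
  have hu0 : 0 < u := by positivity
  have hu9 : u ≤ 1 / 9 := by rw [hu, inv_le_comm₀ (by linarith) (by norm_num)]; simpa using hy'
  have hNJ : (N:ℝ) ≤ J * u := by
    rw [hu, ← div_eq_mul_inv, hN]; exact Nat.cast_div_le
  have hsJ : (Nat.sqrt X : ℝ) ≤ J * u := by
    rw [hu, ← div_eq_mul_inv, le_div_iff₀ (by linarith)]; exact h1
  rw [div_eq_mul_inv] at hAcard hlower ⊢
  rw [← hu] at hAcard hlower ⊢
  by_contra hcon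
  push Not at hcon
  have hJ0 : (0:ℝ) ≤ J := by positivity
  have h6 : (J:ℝ) - 3 * (J * u) < A.card - G.card := by linarith
  have h7 : (1 + 9 * u) * (J - 3 * (J * u)) < (1 + 9 * u) * (A.card - G.card) :=
    mul_lt_mul_of_pos_left h6 (by linarith)
  have h8 : 0 ≤ J * (3 * u - 27 * u ^ 2) := by
    apply mul_nonneg hJ0
    nlinarith
  nlinarith

end S7

namespace S7

lemma prod_zeta_two (y : ℕ) :
    ∏ p ∈ PS y, (1 - ((p:ℝ) ^ 2)⁻¹)⁻¹ ≤ Real.pi ^ 2 / 6 := by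
  let f : ℕ →* ℝ :=
    { toFun := fun n => ((n:ℝ) ^ 2)⁻¹
      map_one' := by simp
      map_mul' := fun a b => by push_cast; rw [mul_pow, mul_inv] }
  have hs : HasSum (fun n : ℕ => f n) (Real.pi ^ 2 / 6) := by
    have := hasSum_zeta_two
    simpa [f] using this
  have e := EulerProduct.prod_primesBelow_geometric_eq_tsum_smoothNumbers (f := f) hs.summable (y+1)
  have hset : PS y = (y+1).primesBelow := by
    ext p
    rw [mem_PS, Nat.mem_primesBelow]
    constructor
    · rintro ⟨h1, h2⟩; exact ⟨by omega, h1⟩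
    · rintro ⟨h1, h2⟩; exact ⟨h2, by omega⟩
  rw [hset]
  calc _ = ∑' m : (y+1).smoothNumbers, f m := e
    _ ≤ ∑' m : ℕ, f m := Summable.tsum_subtype_le _ _ (fun n => by simp only [f, MonoidHom.coe_mk, OneHom.coe_mk]; positivity) hs.summable
    _ = _ := hs.tsum_eq

lemma exp_FF_le (y : ℕ) :
    Real.exp (FF y) ≤ Real.pi ^ 2 / 6 * ∏ p ∈ PS y, (1 + 1 / (p:ℝ)) := by
  have e : Real.exp (FF y) = (∏ p ∈ PS y, (1 - ((p:ℝ) ^ 2)⁻¹)⁻¹) * ∏ p ∈ PS y, (1 + 1 / (p:ℝ)) := by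
    unfold FF
    rw [Real.exp_sum, ← Finset.prod_mul_distrib]
    apply Finset.prod_congr rfl
    intro p hp
    have hp2 : (2:ℝ) ≤ p := by exact_mod_cast (mem_PS.1 hp).1.two_le
    have h1 : 1 / (p:ℝ) ≤ 1 / 2 := by gcongr
    have h0 : 0 < 1 / (p:ℝ) := by positivity
    unfold aw
    rw [Real.exp_neg, Real.exp_log (by linarith)]
    have e2 : (1 - ((p:ℝ) ^ 2)⁻¹) = (1 - 1/(p:ℝ)) * (1 + 1/(p:ℝ)) := by
      have : (p:ℝ) ≠ 0 := by linarith
      field_simp; ring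
    rw [e2, mul_inv, mul_assoc, inv_mul_cancel₀ (by linarith), mul_one]
  rw [e]
  gcongr
  exact prod_zeta_two y

lemma good_bound {y d : ℕ} (hy : 9 ≤ y) {τ : ℝ} (hτ : 0 < τ)
    (hlog : τ ≤ Real.log y - (CM + 10)) (h : Good y d) :
    IsFundamentalDiscriminant d ∧ ∃ χ : DirichletCharacter ℂ d, χ.IsPrimitive ∧ MulChar.IsQuadratic χ ∧
      (LFun d χ 1).re ≤ Real.pi ^ 2 / (6 * Real.exp Real.eulerMascheroniConstant * τ) := by
  obtain ⟨h4, hsq, hd, χ, hprim, hquad, hL⟩ := h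
  refine ⟨⟨Nat.pos_of_ne_zero hd.out, Or.inl ⟨h4, hsq⟩⟩, χ, hprim, hquad, ?_⟩
  have e : LFun d χ 1 = χ.LFunction 1 := by
    unfold LFun
    rw [dif_pos hd.out]
  rw [e]
  set P := ∏ p ∈ PS y, (1 + 1 / (p:ℝ)) with hP
  have hPpos : 0 < P := Finset.prod_pos (fun p _ => by positivity)
  have hF := exp_FF_le y
  have hM := mertens_lower (y := y) (by omega)
  have hy' : (9:ℝ) ≤ y := by exact_mod_cast hy
  set l := Real.log y with hl
  have hl0 : 0 < l := Real.log_pos (by linarith)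
  have hly : l ≤ y := (Real.log_le_sub_one_of_pos (by linarith)).trans (by linarith)
  set γ := Real.eulerMascheroniConstant
  have hexp : l * Real.exp γ * Real.exp (-((CM+1)/l)) ≤ Real.pi ^ 2 / 6 * P := by
    refine le_trans ?_ hF
    calc _ = Real.exp (Real.log l + γ - (CM+1)/l) := by
          rw [sub_eq_add_neg, Real.exp_add, Real.exp_add, Real.exp_log hl0]
      _ ≤ _ := Real.exp_le_exp.2 hM
  have h9 : (1 + 9 / (y:ℝ)) * Real.exp (-(9/l)) ≤ 1 := by
    have : 1 + 9/(y:ℝ) ≤ Real.exp (9/l) := by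
      have h1 : 9/(y:ℝ) ≤ 9/l := by gcongr
      have := Real.add_one_le_exp (9/l)
      linarith
    calc _ ≤ Real.exp (9/l) * Real.exp (-(9/l)) := by gcongr
      _ = 1 := by rw [← Real.exp_add]; simp
  have hτl : τ ≤ l * (Real.exp (-((CM+1)/l)) * Real.exp (-(9/l))) := by
    have h1 : -((CM+10)/l) + 1 ≤ Real.exp (-((CM+1)/l)) * Real.exp (-(9/l)) := by
      rw [← Real.exp_add]
      have := Real.add_one_le_exp (-((CM+10)/l))
      convert this using 2
      ring
    calc τ ≤ l * (-((CM+10)/l) + 1) := by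
          have : l * (-((CM+10)/l) + 1) = l - (CM+10) := by field_simp; ring
          linarith
      _ ≤ _ := by gcongr
  have hγ := Real.exp_pos γ
  rw [le_div_iff₀ (by positivity)]
  -- reduce to the product bound
  rcases le_or_gt (χ.LFunction 1).re 0 with hneg | hpos
  · have : (χ.LFunction 1).re * (6 * Real.exp γ * τ) ≤ 0 :=
      mul_nonpos_of_nonpos_of_nonneg hneg (by positivity)
    have := sq_nonneg Real.pi
    linarith
  · set R := (χ.LFunction 1).re
    set A := Real.exp (-((CM+1)/l))
    set B := Real.exp (-(9/l))
    have hB : 0 < B := Real.exp_pos _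
    have hA : 0 < A := Real.exp_pos _
    calc R * (6 * Real.exp γ * τ) ≤ R * (6 * Real.exp γ * (l * (A * B))) := by gcongr
      _ = 6 * R * B * (l * Real.exp γ * A) := by ring
      _ ≤ 6 * R * B * (Real.pi ^ 2 / 6 * P) := by gcongr
      _ = Real.pi ^ 2 * ((R * P) * B) := by ring
      _ ≤ Real.pi ^ 2 * ((1 + 9/(y:ℝ)) * B) := by gcongr
      _ ≤ Real.pi ^ 2 * 1 := by gcongr
      _ = _ := by ring

open Classical in
/-- counting with explicit size parameters -/
lemma count_final {y : ℕ} (hy : 9 ≤ y) {D E s : ℝ} (hs : 0 < s) (hD : D = s ^ 2) (hE : 64 ≤ E)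
    (hEs : E ^ 6 ≤ s) (hP : (PP y : ℝ) ≤ E) (hyE : (y:ℝ) ≤ E) (hlog : 1 + Real.log D ≤ E) :
    D / E ^ 4 ≤ (((Finset.range (⌊D⌋₊+1)).filter (Good y)).card : ℝ) := by
  have hE0 : 0 < E := by linarith
  have hE1 : 1 ≤ E := by linarith
  have hD0 : 0 < D := by rw [hD]; positivity
  have hPpos : (0:ℝ) < PP y := by exact_mod_cast Nat.pos_of_ne_zero (PP_ne_zero y)
  have hy9 : (9:ℝ) ≤ y := by exact_mod_cast hy
  have hs1 : 64 * E ^ 5 ≤ s := by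
    refine le_trans ?_ hEs
    calc 64 * E ^ 5 ≤ E * E ^ 5 := by gcongr
      _ = _ := by ring
  have hs64 : 64 * E ≤ s := by
    refine le_trans ?_ hs1
    gcongr
    calc E = E ^ 1 := (pow_one E).symm
      _ ≤ E ^ 5 := pow_le_pow_right₀ hE1 (by norm_num)
  have hsE3 : 64 * E ^ 3 ≤ s := by
    refine le_trans ?_ hs1
    gcongr
    norm_num
  have hs2 : 64 ≤ s := by linarith
  set X := ⌊D⌋₊ with hX
  have hXD : (X:ℝ) ≤ D := Nat.floor_le hD0.le
  have hXD2 : D / 2 ≤ X := by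
    have := Nat.lt_floor_add_one D
    have : 2 ≤ D := by rw [hD]; nlinarith
    linarith
  set J := X / (4 * PP y) with hJ
  set N := J / y with hN
  have hJ1 : D / (16 * E) ≤ J := by
    have h1 : (X:ℝ) / ((4 * PP y : ℕ):ℝ) < J + 1 := by
      have := Nat.lt_div_mul_add (a := X) (b := 4 * PP y) (by have := PP_ne_zero y; omega)
      rw [div_lt_iff₀ (by push_cast; positivity)]
      have : (X:ℝ) < ((J * (4 * PP y) + 4 * PP y : ℕ) : ℝ) := by exact_mod_cast this
      push_cast at this ⊢
      linarith
    have h2 : D / (8 * E) ≤ (X:ℝ) / ((4 * PP y : ℕ):ℝ) := by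
      push_cast
      calc D / (8 * E) = (D / 2) / (4 * E) := by field_simp; norm_num
        _ ≤ _ := by gcongr
    have h3 : 1 ≤ D / (16 * E) := by
      rw [le_div_iff₀ (by positivity), hD]; nlinarith
    have h4 : D / (8 * E) = D / (16 * E) + D / (16 * E) := by field_simp; norm_num
    linarith
  have hJy : D / (16 * E ^ 2) ≤ (J:ℝ) / y := by
    calc D / (16 * E ^ 2) = D / (16 * E) / E := by field_simp
      _ ≤ _ := by gcongr
  have hNN : D / (32 * E ^ 2) ≤ N := by
    have h1 : (J:ℝ) / y < N + 1 := by
      have := Nat.lt_div_mul_add (a := J) (b := y) (by omega)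
      rw [div_lt_iff₀ (by positivity)]
      have : (J:ℝ) < ((N * y + y : ℕ) : ℝ) := by exact_mod_cast this
      push_cast at this ⊢
      linarith
    have h3 : 1 ≤ D / (32 * E ^ 2) := by
      rw [le_div_iff₀ (by positivity), hD]; nlinarith
    have h4 : D / (16 * E ^ 2) = D / (32 * E ^ 2) + D / (32 * E ^ 2) := by field_simp; norm_num
    linarith
  have hsq : √(X:ℝ) ≤ s := by
    rw [Real.sqrt_le_left hs.le, ← hD]; exact hXD
  have hX1 : (1:ℝ) ≤ X := by
    have : 2 ≤ D := by rw [hD]; nlinarith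
    linarith
  have h := count_good hy hJ hN ?_ ?_ ?_
  · refine le_trans (le_trans ?_ hJy) h
    apply div_le_div_of_nonneg_left hD0.le (by positivity)
    nlinarith [sq_nonneg E, mul_le_mul hE hE (by norm_num) hE0.le]
  · have h3 : 1 ≤ D / (32 * E ^ 2) := by
      rw [le_div_iff₀ (by positivity), hD]; nlinarith
    exact_mod_cast h3.trans hNN
  · have h1 : (Nat.sqrt X : ℝ) ≤ s := (Real.nat_sqrt_le_real_sqrt).trans hsq
    calc _ ≤ s * E := by gcongr
      _ ≤ D / (16 * E) := by
        rw [le_div_iff₀ (by positivity), hD]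
        nlinarith [mul_le_mul_of_nonneg_left hsE3 hs.le, mul_pos hs (pow_pos hE0 2), mul_le_mul_of_nonneg_left hE1 (mul_pos hs (pow_pos hE0 2)).le]
      _ ≤ _ := hJ1
  · have hlX : 1 + Real.log X ≤ E := by
      have := Real.log_le_log (by linarith) hXD
      linarith
    have hlX0 : 0 ≤ Real.log X := Real.log_nonneg hX1
    calc _ ≤ 2 * (E * (s * E)) * E := by gcongr
      _ ≤ D / (32 * E ^ 2) := by
        rw [le_div_iff₀ (by positivity), hD]
        nlinarith [mul_le_mul_of_nonneg_left hs1 hs.le]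
      _ ≤ _ := hNN

end S7

namespace S7

lemma fin_le (D : ℝ) (Q : ℕ → Prop) : {d : ℕ | (d:ℝ) ≤ D ∧ Q d}.Finite := by
  apply (Finset.finite_toSet (Finset.range (⌊D⌋₊ + 1))).subset
  intro d hd
  have h : d ≤ ⌊D⌋₊ := Nat.le_floor hd.1
  simp only [Finset.coe_range, Set.mem_Iio]
  omega

lemma card_denom_le (D : ℝ) (hD : 0 ≤ D) :
    (Nat.card {d : ℕ // (d : ℝ) ≤ D ∧ IsFundamentalDiscriminant d} : ℝ) ≤ D := by
  refine le_trans ?_ (Nat.floor_le hD)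
  have h : Nat.card {d : ℕ | (d : ℝ) ≤ D ∧ IsFundamentalDiscriminant d} ≤ (Finset.Ioc 0 ⌊D⌋₊).card := by
    rw [Nat.card_coe_set_eq, ← Set.ncard_coe_finset]
    apply Set.ncard_le_ncard _ (Finset.finite_toSet _)
    intro d hd
    rw [Finset.mem_coe, Finset.mem_Ioc]
    exact ⟨hd.2.1, Nat.le_floor hd.1⟩
  have h2 : Nat.card {d : ℕ // (d : ℝ) ≤ D ∧ IsFundamentalDiscriminant d} ≤ ⌊D⌋₊ := by
    rw [Nat.card_Ioc, Nat.sub_zero] at h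
    exact h
  exact_mod_cast h2

lemma log_small {c : ℝ} (hc : 0 < c) : ∀ᶠ x : ℝ in atTop, Real.log x ≤ c * x := by
  have h := Real.isLittleO_log_id_atTop.bound hc
  filter_upwards [h, eventually_ge_atTop (0:ℝ)] with x hx hx0
  simp only [id, Real.norm_eq_abs, abs_of_nonneg hx0] at hx
  exact (le_abs_self _).trans hx

/-- the size parameters for large `D` -/
lemma params {η : ℝ} (hη : 0 < η) (hη2 : η ≤ 1 / 20) :
    ∀ᶠ D : ℝ in atTop, 1 ≤ D ∧
      0 < Real.log (Real.log D) - 2 * Real.log (Real.log (Real.log D)) ∧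
      ∃ y : ℕ, 9 ≤ y ∧
      Real.log (Real.log D) - 2 * Real.log (Real.log (Real.log D)) ≤ Real.log y - (CM + 10) ∧
      64 ≤ D ^ η ∧ (D ^ η) ^ 6 ≤ D ^ (1 / 2 : ℝ) ∧ (PP y : ℝ) ≤ D ^ η ∧ (y:ℝ) ≤ D ^ η ∧
      1 + Real.log D ≤ D ^ η := by
  have t1 := Real.tendsto_log_atTop
  have t2 := t1.comp t1
  have t3 := t1.comp t2
  filter_upwards [eventually_ge_atTop (1:ℝ),
    (tendsto_rpow_atTop hη).eventually (eventually_ge_atTop (64:ℝ)),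
    (isLittleO_log_rpow_atTop hη).bound (show (0:ℝ) < 1/2 by norm_num),
    t1.eventually (eventually_ge_atTop (1:ℝ)),
    t2.eventually (eventually_ge_atTop (max 1 (Real.log 4 / η))),
    t1.eventually (log_small (show (0:ℝ) < 1/18 by norm_num)),
    t2.eventually (log_small (show (0:ℝ) < 1/3 by norm_num)),
    t3.eventually (eventually_ge_atTop (CM + 11))] with D hD hE hlE hu hL2 hLu hL3 hL3C
  simp only [Function.comp_apply] at hL2 hL3 hL3C
  set u := Real.log D with hudef
  set v := Real.log u with hv
  set w := Real.log v with hw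
  have hv1 : 1 ≤ v := (le_max_left _ _).trans hL2
  have hv4 : Real.log 4 ≤ v * η := by
    have := (le_max_right _ _).trans hL2
    rwa [div_le_iff₀ hη] at this
  have hv0 : 0 < v := by linarith
  have hu0 : 0 < u := by linarith
  have hD0 : 0 < D := by linarith
  have hq : 18 ≤ u / v := by rw [le_div_iff₀ hv0]; linarith
  have hyle : ((⌊u / v⌋₊ : ℕ) : ℝ) ≤ u / v := Nat.floor_le (by positivity)
  have hylt := Nat.lt_floor_add_one (u / v)
  have hlogD : 1 + u ≤ D ^ η := by
    rw [Real.norm_eq_abs, Real.norm_eq_abs, abs_of_nonneg hu0.le,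
      abs_of_nonneg (by positivity)] at hlE
    linarith
  refine ⟨hD, by linarith, ⌊u / v⌋₊, Nat.le_floor (by push_cast; linarith), ?_, hE, ?_, ?_, ?_, hlogD⟩
  · have h1 : u / v / 2 ≤ ((⌊u / v⌋₊ : ℕ) : ℝ) := by linarith
    have h2 := Real.log_le_log (by positivity) h1
    rw [Real.log_div (by positivity) (by norm_num), Real.log_div hu0.ne' hv0.ne', ← hv, ← hw] at h2
    have := Real.log_two_lt_d9
    linarith
  · rw [← Real.rpow_natCast, ← Real.rpow_mul hD0.le]
    apply Real.rpow_le_rpow_of_exponent_le hD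
    push_cast
    linarith
  · calc (PP ⌊u / v⌋₊ : ℝ) ≤ ((4 ^ ⌊u / v⌋₊ : ℕ) : ℝ) := by exact_mod_cast PP_le _
      _ = Real.exp (Real.log 4 * ⌊u / v⌋₊) := by
          rw [mul_comm, Real.exp_nat_mul, Real.exp_log (by norm_num)]; push_cast; rfl
      _ ≤ Real.exp (u * η) := by
          apply Real.exp_le_exp.2
          have h4 : 0 ≤ Real.log 4 := Real.log_nonneg (by norm_num)
          calc Real.log 4 * ⌊u / v⌋₊ ≤ (v * η) * (u / v) := by gcongr
            _ = u * η := by field_simp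
      _ = D ^ η := by rw [Real.rpow_def_of_pos hD0]
  · have : u / v ≤ u := div_le_self hu0.le hv1
    linarith

end S7

/-- fix `ε > 0` and let `τ = log log D - 2 log log log D`. The proportion of
fundamental discriminants `d ≤ D` with `L(1, χ_d) ≤ π²/(6 e^γ τ)` is at least `D^{-ε}` for all
sufficiently large `D`. -/
theorem statement_7 (ε : ℝ) (hε : 0 < ε) :
    ∀ᶠ D : ℝ in atTop,
      D ^ (-ε) ≤
        (Nat.card {d : ℕ // (d : ℝ) ≤ D ∧ IsFundamentalDiscriminant d ∧
            ∃ χ : DirichletCharacter ℂ d, χ.IsPrimitive ∧ MulChar.IsQuadratic χ ∧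
              (LFun d χ 1).re ≤
                Real.pi ^ 2 / (6 * Real.exp Real.eulerMascheroniConstant *
                  (Real.log (Real.log D) - 2 * Real.log (Real.log (Real.log D))))} : ℝ) /
          (Nat.card {d : ℕ // (d : ℝ) ≤ D ∧ IsFundamentalDiscriminant d} : ℝ) := by
  classical
  set η := min (ε / 4) (1 / 20) with hηdef
  have hη : 0 < η := lt_min (by linarith) (by norm_num)
  have hη4 : 4 * η ≤ ε := by have : η ≤ ε / 4 := min_le_left _ _; linarith
  filter_upwards [S7.params hη (min_le_right _ _)] with D hDD
  obtain ⟨hD1, hτ, y, hy, hlog, hE, hE6, hP, hyE, hlE⟩ := hDD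
  set τ := Real.log (Real.log D) - 2 * Real.log (Real.log (Real.log D))
  have hD0 : 0 < D := by linarith
  have hs : D = (D ^ (1 / 2 : ℝ)) ^ 2 := by
    rw [← Real.rpow_natCast, ← Real.rpow_mul hD0.le]; norm_num
  have hc := S7.count_final hy (by positivity) hs hE hE6 hP hyE hlE
  have hden := S7.card_denom_le D hD0.le
  set M := Nat.card {d : ℕ // (d : ℝ) ≤ D ∧ IsFundamentalDiscriminant d} with hM
  set K := Nat.card {d : ℕ // (d : ℝ) ≤ D ∧ IsFundamentalDiscriminant d ∧
            ∃ χ : DirichletCharacter ℂ d, χ.IsPrimitive ∧ MulChar.IsQuadratic χ ∧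
              (LFun d χ 1).re ≤
                Real.pi ^ 2 / (6 * Real.exp Real.eulerMascheroniConstant * τ)} with hK
  have hKc : ((Finset.range (⌊D⌋₊+1)).filter (S7.Good y)).card ≤ K := by
    have hf := S7.fin_le D (fun d => IsFundamentalDiscriminant d ∧
            ∃ χ : DirichletCharacter ℂ d, χ.IsPrimitive ∧ MulChar.IsQuadratic χ ∧
              (LFun d χ 1).re ≤
                Real.pi ^ 2 / (6 * Real.exp Real.eulerMascheroniConstant * τ))
    have h1 : (((Finset.range (⌊D⌋₊+1)).filter (S7.Good y) : Finset ℕ) : Set ℕ) ⊆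
        {d : ℕ | (d : ℝ) ≤ D ∧ IsFundamentalDiscriminant d ∧
            ∃ χ : DirichletCharacter ℂ d, χ.IsPrimitive ∧ MulChar.IsQuadratic χ ∧
              (LFun d χ 1).re ≤
                Real.pi ^ 2 / (6 * Real.exp Real.eulerMascheroniConstant * τ)} := by
      intro d hd
      rw [Finset.mem_coe, Finset.mem_filter, Finset.mem_range] at hd
      refine ⟨?_, S7.good_bound hy hτ hlog hd.2⟩
      have : d ≤ ⌊D⌋₊ := by omega
      exact (Nat.le_floor_iff hD0.le).1 this
    have h2 := Set.ncard_le_ncard h1 hf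
    rw [Set.ncard_coe_finset, ← Nat.card_coe_set_eq] at h2
    exact h2
  have hKM : K ≤ M := by
    have hf := S7.fin_le D IsFundamentalDiscriminant
    exact Nat.card_mono hf (fun d hd => ⟨hd.1, hd.2.1⟩)
  have hK1 : D / (D ^ η) ^ 4 ≤ K := hc.trans (by exact_mod_cast hKc)
  have hKpos : (0:ℝ) < K := lt_of_lt_of_le (by positivity) hK1
  have hMpos : (0:ℝ) < M := lt_of_lt_of_le hKpos (by exact_mod_cast hKM)
  calc D ^ (-ε) ≤ D ^ (-(η * (4:ℕ))) := by
        apply Real.rpow_le_rpow_of_exponent_le hD1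
        push_cast; linarith
    _ = (D / (D ^ η) ^ 4) / D := by
        rw [Real.rpow_neg hD0.le, Real.rpow_mul hD0.le, Real.rpow_natCast]
        field_simp
    _ ≤ K / D := by gcongr
    _ ≤ K / M := by gcongr
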